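/- arXiv:2509.10991 — 8 statements merged into one kernel-verified Lean document; each statement's English description precedes it below -/
import Mathlib

section
/- Let K be an algebraically closed field of characteristic zero, q a positive natural number, ι a type, and let F, G : ι → Matrix (Fin q) (Fin q) K both be (1,1)-quantum-nonvanishing. Then Matrix.trace ((w.map F).prod) = Matrix.trace ((w.map G).prod) for every word w : List ι if and only if there exists an invertible matrix T (an element of GL (Fin q) K) such that T * F i * T⁻¹ = G i for every i : ι. (Paper's Theorem 5.2, thm:binary.) -/
section SemisimpleTrace

variable {K B : Type*} [Field K] [Ring B] [Algebra K B]

theorem IsSemisimpleRing.exists_mul_eq_zero_and_one_sub_mem {B : Type*} [Ring B]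
    [IsSemisimpleRing B] (I : Ideal B) : ∃ e : B, (∀ b ∈ I, b * e = 0) ∧ 1 - e ∈ I := by
  obtain ⟨J, hJ⟩ := exists_isCompl I
  obtain ⟨i, hi, e, he, hie⟩ := Submodule.mem_sup.mp
    (hJ.sup_eq_top ▸ Submodule.mem_top : (1 : B) ∈ I ⊔ J)
  refine ⟨e, fun b hb => ?_, by rwa [← hie, add_sub_cancel_right]⟩
  have h : b * e = b - b * i := by rw [eq_sub_iff_add_eq, ← mul_add, add_comm, hie, mul_one]
  exact Submodule.disjoint_def.mp hJ.disjoint _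
    (h ▸ I.sub_mem hb (I.mul_mem_left b hi)) (J.mul_mem_left b he)

/-- The character of a module over a `K`-algebra. -/
noncomputable def moduleTrace (K : Type*) {B : Type*} [Field K] [Ring B] [Algebra K B]
    (V : Type*) [AddCommGroup V] [Module K V] [Module B V] [IsScalarTower K B V] (b : B) : K :=
  LinearMap.trace K V (Algebra.lsmul K K V b)

variable {V W : Type*} [AddCommGroup V] [Module K V] [Module B V] [IsScalarTower K B V]
  [AddCommGroup W] [Module K W] [Module B W] [IsScalarTower K B W]

theorem moduleTrace_congr (e : V ≃ₗ[B] W) (b : B) : moduleTrace K V b = moduleTrace K W b := by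
  rw [moduleTrace, ← LinearMap.trace_conj' _ (e.restrictScalars K), moduleTrace]
  congr 1
  ext w
  simp [LinearEquiv.conj_apply]

variable [Module.Finite K V]

theorem moduleTrace_prod [Module.Finite K W] (b : B) :
    moduleTrace K (V × W) b = moduleTrace K V b + moduleTrace K W b := by
  simp only [moduleTrace]
  rw [← LinearMap.trace_prodMap']
  rfl

theorem moduleTrace_add_of_isCompl {p p' : Submodule B V} (h : IsCompl p p') (b : B) :
    moduleTrace K p b + moduleTrace K p' b = moduleTrace K V b := by
  have : Module.Finite K p := Module.Finite.of_injective
    (p.subtype.restrictScalars K) p.subtype_injective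
  have : Module.Finite K p' := Module.Finite.of_injective
    (p'.subtype.restrictScalars K) p'.subtype_injective
  rw [← moduleTrace_prod, moduleTrace_congr (Submodule.prodEquivOfIsCompl p p' h)]

variable [CharZero K] [IsSemisimpleRing B]

theorem exists_ker_toSpanSingleton_le_of_moduleTrace_eq
    (h : ∀ b : B, moduleTrace K V b = moduleTrace K W b) {v : V} (hv : v ≠ 0) :
    ∃ w : W, w ≠ 0 ∧
      LinearMap.ker (LinearMap.toSpanSingleton B V v) ≤
        LinearMap.ker (LinearMap.toSpanSingleton B W w) := by
  obtain ⟨e, he, he'⟩ := IsSemisimpleRing.exists_mul_eq_zero_and_one_sub_mem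
    (LinearMap.ker (LinearMap.toSpanSingleton B V v))
  have hev : e • v = v := by
    have : (1 - e) • v = 0 := he'
    rw [sub_smul, one_smul, sub_eq_zero] at this
    exact this.symm
  have hidem : IsIdempotentElem e := by
    have := he _ he'
    rw [sub_mul, one_mul, sub_eq_zero] at this
    exact this.symm
  have hne : ∃ w : W, e • w ≠ 0 := by
    by_contra! hW
    have hW0 : Algebra.lsmul K K W e = 0 := LinearMap.ext hW
    have hV : LinearMap.trace K V (Algebra.lsmul K K V e) = 0 := by
      have := h e
      rwa [moduleTrace, moduleTrace, hW0, map_zero] at this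
    have hV0 := LinearMap.IsIdempotentElem.eq_zero_of_trace_eq_zero
      (hidem.map (Algebra.lsmul K K V)) hV
    exact hv (hev ▸ LinearMap.congr_fun hV0 v)
  obtain ⟨w, hw⟩ := hne
  refine ⟨e • w, hw, fun b hb => ?_⟩
  simp [smul_smul, he b hb]

theorem exists_submodule_linearEquiv_of_moduleTrace_eq
    (h : ∀ b : B, moduleTrace K V b = moduleTrace K W b) (S : Submodule B V)
    [IsSimpleModule B S] : ∃ S' : Submodule B W, Nonempty (S ≃ₗ[B] S') := by
  have := IsSimpleModule.nontrivial B S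
  obtain ⟨s, hs⟩ := exists_ne (0 : S)
  obtain ⟨w, hw, hle⟩ := exists_ker_toSpanSingleton_le_of_moduleTrace_eq h
    (v := (s : V)) (by simpa using hs)
  have hle' : LinearMap.ker (LinearMap.toSpanSingleton B S s) ≤
      LinearMap.ker (LinearMap.toSpanSingleton B W w) :=
    fun b hb => hle (by simpa using congrArg (Subtype.val) hb)
  have hmax := IsSimpleModule.ker_toSpanSingleton_isMaximal B hs
  have heq := hmax.eq_of_le (fun htop => hw <| by
    simpa using (Ideal.eq_top_iff_one _).mp htop) hle'
  exact ⟨_, ⟨(LinearMap.quotKerEquivOfSurjective _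
    (IsSimpleModule.toSpanSingleton_surjective B hs)).symm ≪≫ₗ
    Submodule.quotEquivOfEq _ _ heq ≪≫ₗ LinearMap.quotKerEquivRange _⟩⟩

/-- Finite-dimensional modules over a semisimple algebra in characteristic zero are determined by
their characters. -/
theorem nonempty_linearEquiv_of_moduleTrace_eq [Module.Finite K W]
    (h : ∀ b : B, moduleTrace K V b = moduleTrace K W b) : Nonempty (V ≃ₗ[B] W) := by
  induction hn : Module.finrank K V using Nat.strong_induction_on generalizing V W with
  | _ n ih =>
  subst hn
  rcases subsingleton_or_nontrivial V with hV | hV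
  · have h1 := h 1
    simp only [moduleTrace, map_one, LinearMap.trace_one, Nat.cast_inj] at h1
    have : Subsingleton W := Module.finrank_zero_iff.mp
      (h1.symm.trans (Module.finrank_zero_of_subsingleton (R := K) (M := V)))
    exact ⟨0⟩
  · obtain ⟨S, hS⟩ := IsSemisimpleModule.exists_simple_submodule B V
    obtain ⟨S', ⟨e⟩⟩ := exists_submodule_linearEquiv_of_moduleTrace_eq h S
    obtain ⟨T, hT⟩ := exists_isCompl S
    obtain ⟨T', hT'⟩ := exists_isCompl S'
    have : Module.Finite K S := Module.Finite.of_injective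
      (S.subtype.restrictScalars K) S.subtype_injective
    have : Module.Finite K T := Module.Finite.of_injective
      (T.subtype.restrictScalars K) T.subtype_injective
    have : Module.Finite K T' := Module.Finite.of_injective
      (T'.subtype.restrictScalars K) T'.subtype_injective
    have hlt : Module.finrank K T < Module.finrank K V := by
      have := IsSimpleModule.nontrivial B S
      have hpos : 0 < Module.finrank K S := Module.finrank_pos
      have := ((Submodule.prodEquivOfIsCompl S T hT).restrictScalars K).finrank_eq
      rw [Module.finrank_prod] at this
      omega
    obtain ⟨f⟩ := ih _ hlt (V := T) (W := T') (fun b => by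
      have h1 := h b
      rw [← moduleTrace_add_of_isCompl hT, ← moduleTrace_add_of_isCompl hT',
        moduleTrace_congr e] at h1
      exact add_left_cancel h1) rfl
    exact ⟨(Submodule.prodEquivOfIsCompl S T hT).symm ≪≫ₗ e.prodCongr f ≪≫ₗ
      Submodule.prodEquivOfIsCompl S' T' hT'⟩

end SemisimpleTrace

theorem exists_linearEquiv_intertwining_of_trace_eq {K B V W : Type*} [Field K] [CharZero K]
    [Ring B] [Algebra K B] [IsSemisimpleRing B]
    [AddCommGroup V] [Module K V] [Module.Finite K V]
    [AddCommGroup W] [Module K W] [Module.Finite K W]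
    (ρ : B →ₐ[K] Module.End K V) (σ : B →ₐ[K] Module.End K W)
    (h : ∀ b, LinearMap.trace K V (ρ b) = LinearMap.trace K W (σ b)) :
    ∃ e : V ≃ₗ[K] W, ∀ b v, e (ρ b v) = σ b (e v) := by
  let _ : Module B V := Module.compHom V ρ.toRingHom
  let _ : Module B W := Module.compHom W σ.toRingHom
  have : IsScalarTower K B V := ⟨fun k b v => by
    change ρ (k • b) v = k • ρ b v
    simp⟩
  have : IsScalarTower K B W := ⟨fun k b v => by
    change σ (k • b) v = k • σ b v
    simp⟩
  obtain ⟨e⟩ := nonempty_linearEquiv_of_moduleTrace_eq (K := K) (V := V) (W := W) (B := B) h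
  exact ⟨e.restrictScalars K, fun b v => e.map_smul b v⟩

theorem isSemisimpleRing_of_forall_isNilpotent_mul {K B : Type*} [Field K] [Ring B] [Algebra K B]
    [Module.Finite K B] (h : ∀ b : B, (∀ c, IsNilpotent (b * c)) → b = 0) :
    IsSemisimpleRing B := by
  have : IsArtinianRing B := IsArtinianRing.of_finite K B
  rw [IsArtinianRing.isSemisimpleRing_iff_jacobson, eq_bot_iff]
  intro b hb
  obtain ⟨n, hn⟩ := IsSemiprimaryRing.isNilpotent (R := B)
  refine h b fun c => ⟨n, ?_⟩
  have := Ideal.pow_mem_pow (Ideal.mul_mem_right c _ hb) n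
  rwa [hn] at this

open Matrix in
theorem exists_conj_of_trace_prod_eq {K : Type*} [Field K] [CharZero K]
    {m ι : Type*} [Fintype m] [DecidableEq m] (F G : ι → Matrix m m K)
    (hF : ∀ M ∈ Algebra.adjoin K (Set.range F), M ≠ 0 →
      ∃ N ∈ Algebra.adjoin K (Set.range F), trace (M * N) ≠ 0)
    (hG : ∀ M ∈ Algebra.adjoin K (Set.range G), M ≠ 0 →
      ∃ N ∈ Algebra.adjoin K (Set.range G), trace (M * N) ≠ 0)
    (h : ∀ w : List ι, trace (w.map F).prod = trace (w.map G).prod) :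
    ∃ T : GL m K, ∀ i, (T : Matrix m m K) * F i * ((T⁻¹ : GL m K) : Matrix m m K) = G i := by
  let C := Algebra.adjoin K (Set.range fun i => (F i, G i))
  let φ : C →ₐ[K] Matrix m m K := (AlgHom.fst K _ _).comp C.val
  let γ : C →ₐ[K] Matrix m m K := (AlgHom.snd K _ _).comp C.val
  have hφ : φ.range = Algebra.adjoin K (Set.range F) := by
    rw [AlgHom.range_comp, Subalgebra.range_val, AlgHom.map_adjoin, ← Set.range_comp]
    rfl
  have hγ : γ.range = Algebra.adjoin K (Set.range G) := by
    rw [AlgHom.range_comp, Subalgebra.range_val, AlgHom.map_adjoin, ← Set.range_comp]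
    rfl
  have key : ∀ (ψ : C →ₐ[K] Matrix m m K),
      (∀ M ∈ ψ.range, M ≠ 0 → ∃ N ∈ ψ.range, trace (M * N) ≠ 0) →
      ∀ b, (∀ c, IsNilpotent (b * c)) → ψ b = 0 := by
    intro ψ hψ b hb
    by_contra hne
    obtain ⟨_, ⟨c, rfl⟩, hc⟩ := hψ _ ⟨b, rfl⟩ hne
    have := (hb c).map ψ
    rw [map_mul] at this
    exact hc (isNilpotent_trace_of_isNilpotent this).eq_zero
  have : IsSemisimpleRing C := isSemisimpleRing_of_forall_isNilpotent_mul (K := K) fun b hb =>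
    Subtype.ext (Prod.ext (key φ (hφ ▸ hF) b hb) (key γ (hγ ▸ hG) b hb))
  have htrace : ∀ x ∈ C, trace x.1 = trace x.2 := by
    intro x hx
    rw [← Subalgebra.mem_toSubmodule, Algebra.adjoin_eq_span] at hx
    induction hx using Submodule.span_induction with
    | zero => simp
    | add x y _ _ hx hy => simp [hx, hy]
    | smul k x _ hx => simp [hx]
    | mem x hx =>
      obtain ⟨w, hw⟩ : ∃ w : List ι, x = ((w.map F).prod, (w.map G).prod) := by
        induction hx using Submonoid.closure_induction with
        | mem x hx =>
          obtain ⟨i, rfl⟩ := hx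
          exact ⟨[i], by simp⟩
        | one => exact ⟨[], rfl⟩
        | mul x y _ _ hx hy =>
          obtain ⟨u, rfl⟩ := hx
          obtain ⟨v, rfl⟩ := hy
          exact ⟨u ++ v, by simp⟩
      rw [hw]
      exact h w
  obtain ⟨e, he⟩ := exists_linearEquiv_intertwining_of_trace_eq
    ((toLinAlgEquiv' : Matrix m m K ≃ₐ[K] _).toAlgHom.comp φ)
    ((toLinAlgEquiv' : Matrix m m K ≃ₐ[K] _).toAlgHom.comp γ) (fun b => by
      change LinearMap.trace K _ (toLin' b.1.1) = LinearMap.trace K _ (toLin' b.1.2)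
      rw [trace_toLin'_eq, trace_toLin'_eq]
      exact htrace b b.2)
  let T : GL m K := Units.mapEquiv (toLinAlgEquiv' : Matrix m m K ≃ₐ[K] _).symm.toMulEquiv
    (LinearMap.GeneralLinearGroup.generalLinearEquiv K _ |>.symm e)
  refine ⟨T, fun i => ?_⟩
  rw [Units.mul_inv_eq_iff_eq_mul]
  have hT : toLinAlgEquiv' (T : Matrix m m K) = e.toLinearMap := by
    simp [T]
    rfl
  apply toLinAlgEquiv'.injective
  rw [map_mul, map_mul, hT]
  exact LinearMap.ext fun v => he ⟨(F i, G i), Algebra.subset_adjoin ⟨i, rfl⟩⟩ v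

theorem List.prod_map_conj_units {M ι : Type*} [Monoid M] (u : Mˣ) (f : ι → M) (w : List ι) :
    (w.map fun i => (u : M) * f i * ((u⁻¹ : Mˣ) : M)).prod =
      u * (w.map f).prod * ((u⁻¹ : Mˣ) : M) := by
  induction w with
  | nil => simp
  | cons i w ih =>
    rw [List.map_cons, List.prod_cons, ih, List.map_cons, List.prod_cons]
    simp [mul_assoc]

/-- Theorem 5.2 (thm:binary): for (1,1)-quantum-nonvanishing families of matrices,
equality of all word traces is equivalent to simultaneous similarity. -/
theorem stmt0 {K : Type*} [Field K] [IsAlgClosed K] [CharZero K]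
    {q : ℕ} (hq : 0 < q) {ι : Type*}
    (F G : ι → Matrix (Fin q) (Fin q) K)
    (hF : ∀ M ∈ Algebra.adjoin K (Set.range F), M ≠ 0 →
      ∃ N ∈ Algebra.adjoin K (Set.range F), Matrix.trace (M * N) ≠ 0)
    (hG : ∀ M ∈ Algebra.adjoin K (Set.range G), M ≠ 0 →
      ∃ N ∈ Algebra.adjoin K (Set.range G), Matrix.trace (M * N) ≠ 0) :
    (∀ w : List ι, Matrix.trace ((w.map F).prod) = Matrix.trace ((w.map G).prod)) ↔
    ∃ T : GL (Fin q) K, ∀ i : ι,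
      (T : Matrix (Fin q) (Fin q) K) * F i * ((T⁻¹ : GL (Fin q) K) : Matrix (Fin q) (Fin q) K)
        = G i := by
  constructor
  · exact exists_conj_of_trace_prod_eq F G hF hG
  · rintro ⟨T, hT⟩ w
    rw [← funext hT, List.prod_map_conj_units, Matrix.trace_mul_cycle, Units.inv_mul, one_mul]
end

section
/- Let K be an algebraically closed field of characteristic zero and q a positive natural number. Let A be a unital subalgebra of Matrix (Fin q) (Fin q) K on which the trace bilinear form is nondegenerate (for every M ∈ A with M ≠ 0 there exists N ∈ A with Matrix.trace (M * N) ≠ 0). If every M ∈ A has singleton spectrum, i.e., for each M ∈ A there exists λ : K with spectrum K M = {λ}, then every M ∈ A is a scalar multiple of the identity matrix. (Paper's Corollary cor:kaplansky.) -/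
/-- A square matrix over an algebraically closed field whose only eigenvalue is `0` has trace
`0`. -/
theorem Matrix.trace_eq_zero_of_spectrum_subset_zero {K n : Type*} [Field K] [IsAlgClosed K]
    [Fintype n] [DecidableEq n] {M : Matrix n n K} (h : spectrum K M ⊆ {0}) : M.trace = 0 := by
  rw [Matrix.trace_eq_sum_roots_charpoly]
  refine Multiset.sum_eq_zero fun x hx => ?_
  exact h (Matrix.mem_spectrum_iff_isRoot_charpoly.mpr (Polynomial.isRoot_of_mem_roots hx))

/-- Corollary cor:kaplansky: if the trace form is nondegenerate on a unital
subalgebra of matrices in which every element has singleton spectrum, then the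
subalgebra consists only of scalar multiples of the identity. -/
theorem stmt1 {K : Type*} [Field K] [IsAlgClosed K] [CharZero K]
    {q : ℕ} (hq : 0 < q)
    (A : Subalgebra K (Matrix (Fin q) (Fin q) K))
    (hnd : ∀ M ∈ A, M ≠ 0 → ∃ N ∈ A, Matrix.trace (M * N) ≠ 0)
    (hspec : ∀ M ∈ A, ∃ l : K, spectrum K M = {l}) :
    ∀ M ∈ A, ∃ c : K, M = c • (1 : Matrix (Fin q) (Fin q) K) := by
  intro M hM
  obtain ⟨l, hl⟩ := hspec M hM
  refine ⟨l, ?_⟩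
  have hlM : l ∈ spectrum K M := by simp [hl]
  have hdet : (algebraMap K _ l - M).det = 0 := by
    simpa [spectrum.mem_iff, Matrix.isUnit_iff_isUnit_det] using hlM
  have hA : algebraMap K _ l - M ∈ A := A.sub_mem (A.algebraMap_mem l) hM
  by_contra hne
  obtain ⟨N, hN, htr⟩ := hnd _ hA fun h => hne <| by
    rw [← Algebra.algebraMap_eq_smul_one]
    exact (sub_eq_zero.mp h).symm
  refine htr (Matrix.trace_eq_zero_of_spectrum_subset_zero ?_)
  obtain ⟨m, hm⟩ := hspec _ (A.mul_mem hA hN)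
  have h_zero : (0 : K) ∈ spectrum K ((algebraMap K _ l - M) * N) := by
    rw [spectrum.zero_mem_iff, Matrix.isUnit_iff_isUnit_det, Matrix.det_mul, hdet]
    simp
  rw [hm] at h_zero ⊢
  rw [Set.mem_singleton_iff.mp h_zero]
end

section
/- Let K be an algebraically closed field of characteristic zero, q a positive natural number, and let F, G : ι → Matrix (Fin q) (Fin q) K be trace-equivalent and both (1,1)-quantum-nonvanishing. Then at least one of the following holds: (i) for every noncommutative polynomial p : FreeAlgebra K ι there exists c : K such that ev_F p = c • 1 and ev_G p = c • 1; or (ii) there exist invertible matrices T, U (elements of GL (Fin q) K), a subset X : Finset (Fin q) with X ≠ ∅ and X ≠ Finset.univ, and a noncommutative polynomial p : FreeAlgebra K ι such that evaluating p at the family (fun i => T * F i * T⁻¹) yields I_X and evaluating p at the family (fun i => U * G i * U⁻¹) also yields I_X. (Matrix-family instance of the paper's Lemma lem:subdomain, whose hypotheses and conclusion concern only the (1,1) parts of the gadget closures.) -/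
open Polynomial in
/-- A square matrix over an algebraically closed field, lying in a subalgebra without nontrivial
idempotents, differs from a scalar by a nilpotent matrix. -/
lemma exists_isNilpotent_sub_smul_one {K : Type*} [Field K] [IsAlgClosed K] {n : Type*}
    [Fintype n] [DecidableEq n] [Nonempty n] {A : Subalgebra K (Matrix n n K)}
    (hA : ∀ e ∈ A, IsIdempotentElem e → e = 0 ∨ e = 1) {M : Matrix n n K} (hM : M ∈ A) :
    ∃ c : K, IsNilpotent (M - c • (1 : Matrix n n K)) := by
  obtain ⟨c, hc⟩ := IsAlgClosed.exists_root M.charpoly (by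
    rw [Matrix.charpoly_degree_eq_dim]
    exact_mod_cast Fintype.card_ne_zero)
  have h0 : M.charpoly ≠ 0 := (Matrix.charpoly_monic M).ne_zero
  obtain ⟨r, hr, hdvd⟩ := Polynomial.exists_eq_pow_rootMultiplicity_mul_and_not_dvd M.charpoly h0 c
  set k := M.charpoly.rootMultiplicity c
  have hkpos : 0 < k := (Polynomial.rootMultiplicity_pos h0).2 hc
  have hcop : IsCoprime ((X - C c) ^ k) r :=
    (((Polynomial.irreducible_X_sub_C c).coprime_iff_not_dvd).2 hdvd).pow_left
  obtain ⟨a, b, hab⟩ := hcop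
  have hX : aeval M (X - C c) = M - c • (1 : Matrix n n K) := by
    simp [Algebra.algebraMap_eq_smul_one]
  have hch : aeval M ((X - C c) ^ k * r) = 0 := by
    rw [← hr]; exact Matrix.aeval_self_charpoly M
  refine ⟨c, k, ?_⟩
  rw [← hX]
  have hmem : aeval M (a * (X - C c) ^ k) ∈ A :=
    Algebra.adjoin_le (Set.singleton_subset_iff.2 hM) (Polynomial.aeval_mem_adjoin_singleton K M)
  have hid : IsIdempotentElem (aeval M (a * (X - C c) ^ k)) := by
    have : a * (X - C c) ^ k * (a * (X - C c) ^ k)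
        = a * (X - C c) ^ k - a * b * ((X - C c) ^ k * r) := by
      linear_combination (a * (X - C c) ^ k) * hab
    rw [IsIdempotentElem, ← map_mul, this, map_sub, map_mul _ (a * b), hch, mul_zero, sub_zero]
  rcases hA _ hmem hid with h | h
  · have : (X - C c) ^ k = (X - C c) ^ k * (a * (X - C c) ^ k) + b * ((X - C c) ^ k * r) := by
      linear_combination (-(X - C c) ^ k) * hab
    rw [← map_pow, this, map_add, map_mul, h, map_mul _ b, hch]
    simp
  · exfalso
    have hunit : IsUnit (aeval M (X - C c)) := by
      obtain ⟨j, hj⟩ := Nat.exists_eq_succ_of_ne_zero hkpos.ne'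
      refine IsUnit.of_mul_eq_one_right (aeval M (a * (X - C c) ^ j)) ?_
      rw [← map_mul, ← h, hj, pow_succ, mul_assoc]
    have hneg : -(M - c • (1 : Matrix n n K)) = Matrix.scalar n c - M := by
      rw [neg_sub, Matrix.scalar_apply, Matrix.smul_one_eq_diagonal]
    have hdet := hunit.neg
    rw [hX, hneg, Matrix.isUnit_iff_isUnit_det, ← Matrix.eval_charpoly, hc.eq_zero] at hdet
    exact not_isUnit_zero hdet

/-- In a matrix algebra with nondegenerate trace form and no nontrivial idempotents, every element
is scalar. -/
lemma exists_eq_smul_one_of_isIdempotentElem {K : Type*} [Field K] [IsAlgClosed K] {n : Type*}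
    [Fintype n] [DecidableEq n] [Nonempty n] {A : Subalgebra K (Matrix n n K)}
    (hA : ∀ e ∈ A, IsIdempotentElem e → e = 0 ∨ e = 1)
    (htr : ∀ M ∈ A, M ≠ 0 → ∃ N ∈ A, Matrix.trace (M * N) ≠ 0)
    {M : Matrix n n K} (hM : M ∈ A) : ∃ c : K, M = c • (1 : Matrix n n K) := by
  obtain ⟨c, hc⟩ := exists_isNilpotent_sub_smul_one hA hM
  refine ⟨c, sub_eq_zero.1 ?_⟩
  by_contra hne
  obtain ⟨N, hN, h⟩ := htr _ (A.sub_mem hM (A.smul_mem A.one_mem c)) hne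
  obtain ⟨d, hd⟩ := exists_isNilpotent_sub_smul_one hA
    (A.mul_mem (A.sub_mem hM (A.smul_mem A.one_mem c)) hN)
  have hd0 : d = 0 := by
    by_contra hd0
    have hu : IsUnit ((M - c • (1 : Matrix n n K)) * N) := by
      have h1 : IsUnit (d • (1 : Matrix n n K)) := by
        simpa [Algebra.algebraMap_eq_smul_one] using
          (IsUnit.mk0 d hd0).map (algebraMap K (Matrix n n K))
      have := hd.isUnit_add_left_of_commute h1 ((Commute.one_right _).smul_right d)
      simpa using this
    rw [Matrix.isUnit_iff_isUnit_det, Matrix.det_mul] at hu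
    have hu' := (Matrix.isUnit_iff_isUnit_det _).2 (isUnit_of_mul_isUnit_left hu)
    exact hc.not_isUnit hu'
  rw [hd0, zero_smul, sub_zero] at hd
  exact h (Matrix.isNilpotent_trace_of_isNilpotent hd).eq_zero

/-- An idempotent endomorphism has a basis in which it is the coordinate projection onto a given
set of coordinates whose size is the rank. -/
lemma LinearMap.exists_basis_apply_eq_ite_of_isIdempotentElem {K V n : Type*} [Field K]
    [AddCommGroup V] [Module K V] [FiniteDimensional K V] [Fintype n] [DecidableEq n]
    (hn : Module.finrank K V = Fintype.card n) {f : V →ₗ[K] V} (hf : IsIdempotentElem f)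
    {X : Finset n} (hX : Module.finrank K (LinearMap.range f) = X.card) :
    ∃ b : Module.Basis n K V, ∀ i, f (b i) = if i ∈ X then b i else 0 := by
  have hcompl : IsCompl (LinearMap.range f) (LinearMap.ker f) :=
    LinearMap.IsIdempotentElem.isCompl hf
  have hker : Module.finrank K (LinearMap.ker f) = Fintype.card {i // i ∉ X} := by
    have := LinearMap.finrank_range_add_finrank_ker f
    rw [Fintype.card_subtype_compl, Fintype.card_coe]
    omega
  let b₁ := (Module.finBasis K (LinearMap.range f)).reindex
    (Fintype.equivOfCardEq (by simpa using hX) : _ ≃ {i // i ∈ X})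
  let b₂ := (Module.finBasis K (LinearMap.ker f)).reindex
    (Fintype.equivOfCardEq (by simpa using hker) : _ ≃ {i // i ∉ X})
  refine ⟨((b₁.prod b₂).map (Submodule.prodEquivOfIsCompl _ _ hcompl)).reindex
      (Equiv.sumCompl (· ∈ X)), fun i => ?_⟩
  generalize b₁ = b₁, b₂ = b₂
  by_cases h : i ∈ X
  · obtain ⟨v, hv⟩ := (b₁ ⟨i, h⟩).2
    simpa [h, ← hv] using LinearMap.congr_fun hf.eq v
  · simp [h]

/-- An idempotent matrix is conjugate to the coordinate projection onto any set of coordinates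
whose size is the rank. -/
lemma exists_conj_eq_diagonal_of_isIdempotentElem {K : Type*} [Field K] {n : Type*}
    [Fintype n] [DecidableEq n] {e : Matrix n n K} (he : IsIdempotentElem e) {X : Finset n}
    (hX : Module.finrank K (LinearMap.range (Matrix.toLin' e)) = X.card) :
    ∃ T : GL n K, (T : Matrix n n K) * e * ((T⁻¹ : GL n K) : Matrix n n K)
      = Matrix.diagonal (fun i => if i ∈ X then (1 : K) else 0) := by
  have hid : IsIdempotentElem (Matrix.toLin' e) := by
    rw [IsIdempotentElem, Module.End.mul_eq_comp, ← Matrix.toLin'_mul, he.eq]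
  obtain ⟨b, hb⟩ := LinearMap.exists_basis_apply_eq_ite_of_isIdempotentElem
    (Module.finrank_fintype_fun_eq_card K) hid hX
  have h3 := basis_toMatrix_mul_linearMap_toMatrix_mul_basis_toMatrix b (Pi.basisFun K n) b
    (Pi.basisFun K n) (Matrix.toLin' e)
  rw [LinearMap.toMatrix_eq_toMatrix', LinearMap.toMatrix'_toLin'] at h3
  refine ⟨⟨b.toMatrix (Pi.basisFun K n), (Pi.basisFun K n).toMatrix b,
    Module.Basis.toMatrix_mul_toMatrix_flip _ _,
    Module.Basis.toMatrix_mul_toMatrix_flip _ _⟩, ?_⟩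
  rw [Units.inv_mk]
  refine h3.trans ?_
  ext i j
  rw [LinearMap.toMatrix_apply, hb, Matrix.diagonal_apply]
  by_cases h : j ∈ X <;> by_cases hij : i = j <;> simp_all [eq_comm]

/-- Evaluating a noncommutative polynomial commutes with simultaneous conjugation. -/
lemma FreeAlgebra.lift_conj {K A ι : Type*} [CommSemiring K] [Semiring A] [Algebra K A]
    (F : ι → A) (u : Aˣ) (p : FreeAlgebra K ι) :
    FreeAlgebra.lift K (fun i => (u : A) * F i * ((u⁻¹ : Aˣ) : A)) p
      = u * FreeAlgebra.lift K F p * ((u⁻¹ : Aˣ) : A) := by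
  induction p with
  | grade0 r => simp [Algebra.commutes, mul_assoc]
  | grade1 x => simp
  | mul a b ha hb => rw [map_mul, ha, hb, map_mul]; simp [mul_assoc]
  | add a b ha hb => simp [ha, hb, mul_add, add_mul]

/-- Trace-equivalent families have equal traces on all noncommutative polynomials. -/
lemma trace_lift_eq_of_trace_word_eq {K ι n : Type*} [CommRing K] [Fintype n] [DecidableEq n]
    {F G : ι → Matrix n n K}
    (htr : ∀ w : List ι, Matrix.trace ((w.map F).prod) = Matrix.trace ((w.map G).prod))
    (p : FreeAlgebra K ι) :
    Matrix.trace (FreeAlgebra.lift K F p) = Matrix.trace (FreeAlgebra.lift K G p) := by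
  have key : ∀ r : FreeAlgebra K ι,
      (∀ w : List ι, Matrix.trace (FreeAlgebra.lift K F r * (w.map F).prod)
        = Matrix.trace (FreeAlgebra.lift K G r * (w.map G).prod)) →
      ∀ w : List ι, Matrix.trace (FreeAlgebra.lift K F (r * p) * (w.map F).prod)
        = Matrix.trace (FreeAlgebra.lift K G (r * p) * (w.map G).prod) := by
    induction p with
    | grade0 c =>
      intro r hr w
      simp [Algebra.algebraMap_eq_smul_one, hr w]
    | grade1 x =>
      intro r hr w
      simpa [mul_assoc] using hr (x :: w)
    | mul a b ha hb =>
      intro r hr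
      simpa only [mul_assoc] using hb (r * a) (ha r hr)
    | add a b ha hb =>
      intro r hr w
      simp only [mul_add, map_add, add_mul, Matrix.trace_add, ha r hr w, hb r hr w]
  simpa using key 1 (by simpa using htr) []

/-- If the trace form on the algebra generated by `G` is nondegenerate, polynomial relations
transfer to `G` from any family with the same traces. -/
lemma lift_eq_zero_of_trace_lift_eq {K ι n : Type*} [CommRing K] [Fintype n] [DecidableEq n]
    {F G : ι → Matrix n n K}
    (htr : ∀ p : FreeAlgebra K ι,
      Matrix.trace (FreeAlgebra.lift K F p) = Matrix.trace (FreeAlgebra.lift K G p))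
    (hG : ∀ M ∈ Algebra.adjoin K (Set.range G), M ≠ 0 →
      ∃ N ∈ Algebra.adjoin K (Set.range G), Matrix.trace (M * N) ≠ 0)
    {p : FreeAlgebra K ι} (hp : FreeAlgebra.lift K F p = 0) : FreeAlgebra.lift K G p = 0 := by
  rw [Algebra.adjoin_range_eq_range_freeAlgebra_lift] at hG
  by_contra hne
  obtain ⟨_, ⟨r, rfl⟩, h⟩ := hG _ ⟨p, rfl⟩ hne
  apply h
  have := htr (p * r)
  rw [map_mul, hp, zero_mul, Matrix.trace_zero, map_mul] at this
  exact this.symm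

/-- The trace of an idempotent matrix is its rank. -/
lemma trace_eq_finrank_range_of_isIdempotentElem {K : Type*} [Field K] {n : Type*}
    [Fintype n] [DecidableEq n] {e : Matrix n n K} (he : IsIdempotentElem e) :
    Matrix.trace e = Module.finrank K (LinearMap.range (Matrix.toLin' e)) := by
  have hid : IsIdempotentElem (Matrix.toLin' e) := by
    rw [IsIdempotentElem, Module.End.mul_eq_comp, ← Matrix.toLin'_mul, he.eq]
  rw [← Matrix.trace_toLin'_eq]
  exact (LinearMap.IsIdempotentElem.isProj_range _ hid).trace


/-- Matrix-family instance of Lemma lem:subdomain: trace-equivalent,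
(1,1)-quantum-nonvanishing families either have trivial (scalar) gadget algebras
agreeing on scalars, or after conjugations both realize a common nontrivial
subdomain restrictor I_X. -/
theorem stmt2 {K : Type*} [Field K] [IsAlgClosed K] [CharZero K]
    {q : ℕ} (hq : 0 < q) {ι : Type*}
    (F G : ι → Matrix (Fin q) (Fin q) K)
    (htr : ∀ w : List ι, Matrix.trace ((w.map F).prod) = Matrix.trace ((w.map G).prod))
    (hF : ∀ M ∈ Algebra.adjoin K (Set.range F), M ≠ 0 →
      ∃ N ∈ Algebra.adjoin K (Set.range F), Matrix.trace (M * N) ≠ 0)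
    (hG : ∀ M ∈ Algebra.adjoin K (Set.range G), M ≠ 0 →
      ∃ N ∈ Algebra.adjoin K (Set.range G), Matrix.trace (M * N) ≠ 0) :
    (∀ p : FreeAlgebra K ι, ∃ c : K,
        FreeAlgebra.lift K F p = c • (1 : Matrix (Fin q) (Fin q) K) ∧
        FreeAlgebra.lift K G p = c • (1 : Matrix (Fin q) (Fin q) K)) ∨
    (∃ (T U : GL (Fin q) K) (X : Finset (Fin q)), X ≠ ∅ ∧ X ≠ Finset.univ ∧
      ∃ p : FreeAlgebra K ι,
        FreeAlgebra.lift K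
            (fun i => (T : Matrix (Fin q) (Fin q) K) * F i *
              ((T⁻¹ : GL (Fin q) K) : Matrix (Fin q) (Fin q) K)) p
          = Matrix.diagonal (fun i => if i ∈ X then (1 : K) else 0) ∧
        FreeAlgebra.lift K
            (fun i => (U : Matrix (Fin q) (Fin q) K) * G i *
              ((U⁻¹ : GL (Fin q) K) : Matrix (Fin q) (Fin q) K)) p
          = Matrix.diagonal (fun i => if i ∈ X then (1 : K) else 0)) := by
  classical
  have : Nonempty (Fin q) := ⟨⟨0, hq⟩⟩
  have htr' := trace_lift_eq_of_trace_word_eq htr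
  have hFG : ∀ p, FreeAlgebra.lift K F p = 0 → FreeAlgebra.lift K G p = 0 :=
    fun p => lift_eq_zero_of_trace_lift_eq htr' hG
  have hGF : ∀ p, FreeAlgebra.lift K G p = 0 → FreeAlgebra.lift K F p = 0 :=
    fun p => lift_eq_zero_of_trace_lift_eq (fun p => (htr' p).symm) hF
  by_cases hA : ∀ e ∈ Algebra.adjoin K (Set.range F), IsIdempotentElem e → e = 0 ∨ e = 1
  · left
    intro p
    obtain ⟨c, hc⟩ := exists_eq_smul_one_of_isIdempotentElem hA hF
      (M := FreeAlgebra.lift K F p)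
      (by rw [Algebra.adjoin_range_eq_range_freeAlgebra_lift]; exact ⟨p, rfl⟩)
    refine ⟨c, hc, ?_⟩
    have := hFG (p - c • 1) (by simp [hc])
    simpa [sub_eq_zero] using this
  · right
    push Not at hA
    obtain ⟨e, he, hid, h0, h1⟩ := hA
    rw [Algebra.adjoin_range_eq_range_freeAlgebra_lift] at he
    obtain ⟨p, rfl⟩ := he
    change IsIdempotentElem (FreeAlgebra.lift K F p) at hid
    change FreeAlgebra.lift K F p ≠ 0 at h0
    change FreeAlgebra.lift K F p ≠ 1 at h1
    have hidG : IsIdempotentElem (FreeAlgebra.lift K G p) := by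
      have := hFG (p * p - p) (by simp [hid.eq])
      simpa [sub_eq_zero, IsIdempotentElem] using this
    have hrank : Module.finrank K (LinearMap.range (Matrix.toLin' (FreeAlgebra.lift K G p)))
        = Module.finrank K (LinearMap.range (Matrix.toLin' (FreeAlgebra.lift K F p))) := by
      have := htr' p
      rw [trace_eq_finrank_range_of_isIdempotentElem hid,
        trace_eq_finrank_range_of_isIdempotentElem hidG] at this
      exact_mod_cast this.symm
    obtain ⟨X, -, hX⟩ := Finset.exists_subset_card_eq (s := (Finset.univ : Finset (Fin q)))
      (n := Module.finrank K (LinearMap.range (Matrix.toLin' (FreeAlgebra.lift K F p)))) (by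
        simpa using Submodule.finrank_le (LinearMap.range (Matrix.toLin' (FreeAlgebra.lift K F p))))
    obtain ⟨T, hT⟩ := exists_conj_eq_diagonal_of_isIdempotentElem hid hX.symm
    obtain ⟨U, hU⟩ := exists_conj_eq_diagonal_of_isIdempotentElem hidG (hrank.trans hX.symm)
    refine ⟨T, U, X, ?_, ?_, p, ?_, ?_⟩
    · rintro rfl
      exact h0 (by simpa [-Matrix.coe_units_inv] using hT)
    · rintro rfl
      refine h1 ((Units.mul_right_inj T).1 ?_)
      simpa [-Matrix.coe_units_inv, Units.mul_inv_eq_iff_eq_mul] using hT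
    · rw [FreeAlgebra.lift_conj, hT]
    · rw [FreeAlgebra.lift_conj, hU]
end

section
/- Let ι be a finite type, q a positive natural number, and F, G : ι → Matrix (Fin q) (Fin q) ℂ. Then Matrix.trace ((w.map F).prod) = Matrix.trace ((w.map G).prod) for every word w : List ι if and only if the topological closures of the simultaneous-conjugation orbits Orb(F) and Orb(G) have a common point. (Specialization of the paper's first main theorem, Theorem thm:main1, to families of mixed binary signatures, i.e., square matrices, for which Bi-Holant-indistinguishability is exactly equality of all word traces.) -/
section SemisimpleTrace

open Module

theorem exists_smul_projection_isotypicComponents {R W : Type*} [Ring R] [AddCommGroup W]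
    [Module R W] [IsSemisimpleModule R W] [Module.Finite (End R W) W] {X : Submodule R W}
    (hX : X ∈ isotypicComponents R W) :
    ∃ a : R, (∀ x ∈ X, a • x = x) ∧ ∀ x : W, a • x ∈ X := by
  set C : Submodule R W := sSup (isotypicComponents R W \ {X}) with hC
  have hXC : IsCompl X C := by
    refine ⟨sSupIndep_isotypicComponents R W hX, codisjoint_iff.mpr ?_⟩
    rw [hC, ← sSup_insert, Set.insert_sdiff_singleton, Set.insert_eq_of_mem hX,
      sSup_isotypicComponents]
  have hXinv : X.IsFullyInvariant := .of_mem_isotypicComponents hX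
  have hCinv : C.IsFullyInvariant :=
    isFullyInvariant_iff_sSup_isotypicComponents.mpr ⟨_, Set.sdiff_subset, rfl⟩
  let p : End (End R W) W :=
    { toFun := X.projection C hXC
      map_add' := map_add _
      map_smul' := fun f x => by
        have hx : x ∈ X ⊔ C := hXC.sup_eq_top ▸ Submodule.mem_top
        obtain ⟨u, hu, v, hv, rfl⟩ := Submodule.mem_sup.mp hx
        simp only [End.smul_def, map_add, RingHom.id_apply,
          Submodule.projection_apply_of_mem_left hXC hu,
          Submodule.projection_apply_of_mem_left hXC (hXinv f hu),
          Submodule.projection_apply_of_mem_right hXC hv,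
          Submodule.projection_apply_of_mem_right hXC (hCinv f hv), map_zero] }
  obtain ⟨a, ha⟩ := Module.Finite.toModuleEnd_moduleEnd_surjective (R := R) (M := W) p
  have ha' : ∀ x : W, a • x = X.projection C hXC x := fun x => congr($ha x)
  exact ⟨a, fun x hx => by rw [ha', Submodule.projection_apply_of_mem_left hXC hx],
    fun x => by rw [ha']; exact Submodule.projection_apply_mem hXC x⟩

universe u

variable {k R : Type*} [Field k] [Ring R] [Algebra k R]

theorem LinearEquiv.trace_lsmul_eq {M N : Type*} [AddCommGroup M] [Module k M] [Module R M]
    [IsScalarTower k R M] [AddCommGroup N] [Module k N] [Module R N] [IsScalarTower k R N]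
    (e : M ≃ₗ[R] N) (a : R) :
    LinearMap.trace k M (Algebra.lsmul k k M a) = LinearMap.trace k N (Algebra.lsmul k k N a) := by
  rw [← LinearMap.trace_conj' _ (e.restrictScalars k)]
  congr 1
  ext x
  simp [LinearEquiv.conj_apply]

theorem trace_lsmul_prod {M N : Type*} [AddCommGroup M] [Module k M] [Module R M]
    [IsScalarTower k R M] [AddCommGroup N] [Module k N] [Module R N] [IsScalarTower k R N]
    [FiniteDimensional k M] [FiniteDimensional k N] (a : R) :
    LinearMap.trace k (M × N) (Algebra.lsmul k k (M × N) a) =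
      LinearMap.trace k M (Algebra.lsmul k k M a) + LinearMap.trace k N (Algebra.lsmul k k N a) := by
  rw [← LinearMap.trace_prodMap']
  rfl

variable [CharZero k]

/-- A simple submodule of `M` embeds into `N` if `M` and `N` are semisimple with equal trace
functions. -/
theorem exists_simple_linearEquiv_of_trace_lsmul_eq {M N : Type*} [AddCommGroup M] [Module k M]
    [Module R M] [IsScalarTower k R M] [AddCommGroup N] [Module k N] [Module R N]
    [IsScalarTower k R N] [FiniteDimensional k M] [FiniteDimensional k N]
    [IsSemisimpleModule R M] [IsSemisimpleModule R N]
    (h : ∀ a : R, LinearMap.trace k M (Algebra.lsmul k k M a) =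
      LinearMap.trace k N (Algebra.lsmul k k N a))
    (S : Submodule R M) [IsSimpleModule R S] :
    ∃ T : Submodule R N, Nonempty (S ≃ₗ[R] T) := by
  let e : S ≃ₗ[R] S.map (LinearMap.inl R M N) :=
    S.equivMapOfInjective _ LinearMap.inl_injective
  have hsimple : IsSimpleModule R (S.map (LinearMap.inl R M N)) := IsSimpleModule.congr e.symm
  have : Module.Finite (End R (M × N)) (M × N) :=
    Module.Finite.of_restrictScalars_finite k (End R (M × N)) (M × N)
  have : IsSemisimpleModule R (M × N) := by
    have h := IsSemisimpleModule.sup (.range (LinearMap.inl R M N)) (.range (LinearMap.inr R M N))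
    rw [LinearMap.sup_range_inl_inr] at h
    exact .congr Submodule.topEquiv.symm
  set X := isotypicComponent R (M × N) (S.map (LinearMap.inl R M N)) with hX
  obtain ⟨a, ha, haX⟩ := exists_smul_projection_isotypicComponents
    (X := X) ⟨_, hsimple, rfl⟩
  have hidem : ∀ z : M × N, a • a • z = a • z := fun z => ha _ (haX z)
  have hM : LinearMap.trace k M (Algebra.lsmul k k M a) ≠ 0 := by
    have hi : IsIdempotentElem (Algebra.lsmul k k M a) := by
      ext m
      exact congr(($(hidem (m, 0))).1)
    rw [Ne, LinearMap.IsIdempotentElem.trace_eq_zero_iff hi]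
    intro h0
    have := IsSimpleModule.nontrivial R S
    obtain ⟨s, hs⟩ := exists_ne (0 : S)
    have h1 : a • ((s : M), (0 : N)) = ((s : M), (0 : N)) :=
      ha _ (Submodule.le_isotypicComponent _ ⟨s, s.2, rfl⟩)
    have h2 : a • (s : M) = s := congr(($h1).1)
    have h3 : a • (s : M) = 0 := congr($h0 (s : M))
    exact hs (Subtype.ext (h2.symm.trans h3))
  rw [h] at hM
  obtain ⟨n, hn⟩ : ∃ n : N, a • n ≠ 0 := by
    by_contra! hc
    exact hM (by rw [show Algebra.lsmul k k N a = 0 from LinearMap.ext hc, map_zero])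
  have hne : X.comap (LinearMap.inr R M N) ≠ ⊥ := by
    refine (Submodule.ne_bot_iff _).mpr ⟨a • n, ?_, hn⟩
    have := haX (0, n)
    simpa using! this
  obtain ⟨T, hT, hTs⟩ := (IsSemisimpleModule.eq_bot_or_exists_simple_le _).resolve_left hne
  let eT : T ≃ₗ[R] T.map (LinearMap.inr R M N) :=
    T.equivMapOfInjective _ LinearMap.inr_injective
  have : IsSimpleModule R (T.map (LinearMap.inr R M N)) := IsSimpleModule.congr eT.symm
  obtain ⟨g⟩ := isIsotypicOfType_submodule_iff.mp
    (IsIsotypicOfType.isotypicComponent R (M × N) (S.map (LinearMap.inl R M N)))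
    (T.map (LinearMap.inr R M N)) (Submodule.map_le_iff_le_comap.mpr hT)
  exact ⟨T, ⟨(e.trans g.symm).trans eT.symm⟩⟩

/-- Finite-dimensional semisimple modules over an algebra over a field of characteristic zero are
determined by their trace functions. -/
theorem nonempty_linearEquiv_of_trace_lsmul_eq (M N : Type u) [AddCommGroup M] [Module k M]
    [Module R M] [IsScalarTower k R M] [AddCommGroup N] [Module k N] [Module R N]
    [IsScalarTower k R N] [FiniteDimensional k M] [FiniteDimensional k N]
    [IsSemisimpleModule R M] [IsSemisimpleModule R N]
    (h : ∀ a : R, LinearMap.trace k M (Algebra.lsmul k k M a) =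
      LinearMap.trace k N (Algebra.lsmul k k N a)) :
    Nonempty (M ≃ₗ[R] N) := by
  induction hd : finrank k M using Nat.strong_induction_on generalizing M N with
  | _ d ih =>
  have hrank : finrank k M = finrank k N := by
    have h1 := h 1
    rw [map_one (Algebra.lsmul k k M), map_one (Algebra.lsmul k k N), LinearMap.trace_one,
      LinearMap.trace_one] at h1
    exact_mod_cast h1
  rcases subsingleton_or_nontrivial M with hM | hM
  · have : Subsingleton N := by
      rw [← finrank_zero_iff (R := k), ← hrank, finrank_zero_iff]
      exact hM
    exact ⟨0⟩
  obtain ⟨S, -, hS⟩ := (IsSemisimpleModule.eq_bot_or_exists_simple_le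
    (⊤ : Submodule R M)).resolve_left top_ne_bot
  obtain ⟨T, ⟨e⟩⟩ := exists_simple_linearEquiv_of_trace_lsmul_eq h S
  obtain ⟨S', hS'⟩ := exists_isCompl S
  obtain ⟨T', hT'⟩ := exists_isCompl T
  have hfin (V : Type u) [AddCommGroup V] [Module k V] [Module R V] [IsScalarTower k R V]
      [FiniteDimensional k V] (U : Submodule R V) : FiniteDimensional k U :=
    FiniteDimensional.of_injective (U.subtype.restrictScalars k) U.subtype_injective
  have := hfin M S
  have := hfin M S'
  have := hfin N T
  have := hfin N T'
  let eM := S.prodEquivOfIsCompl S' hS'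
  let eN := T.prodEquivOfIsCompl T' hT'
  have hlt : finrank k S' < d := by
    have := IsSimpleModule.nontrivial R S
    rw [← hd, ← (eM.restrictScalars k).finrank_eq, finrank_prod]
    have : 0 < finrank k S := finrank_pos
    omega
  obtain ⟨e'⟩ := ih _ hlt S' T' (fun a => by
    have := h a
    rw [← eM.trace_lsmul_eq, ← eN.trace_lsmul_eq, trace_lsmul_prod, trace_lsmul_prod,
      e.trace_lsmul_eq] at this
    exact add_left_cancel this) rfl
  exact ⟨(eM.symm.trans (e.prodCongr e')).trans eN⟩

end SemisimpleTrace

section MatrixRep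

open Matrix MonoidAlgebra

variable {ι : Type*} {n : Type*} [Fintype n] [DecidableEq n]

/-- The representation of the free monoid on `ι` sending the generator `i` to the matrix `F i`. -/
noncomputable def wordRep (F : ι → Matrix n n ℂ) :
    Representation ℂ (FreeMonoid ι) (n → ℂ) :=
  (Matrix.toLinAlgEquiv' : Matrix n n ℂ ≃ₐ[ℂ] _).toAlgHom.toMonoidHom.comp (FreeMonoid.lift F)

theorem wordRep_of (F : ι → Matrix n n ℂ) (i : ι) (v : n → ℂ) :
    wordRep F (FreeMonoid.of i) v = F i *ᵥ v := by
  simp [wordRep]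

theorem trace_wordRep (F : ι → Matrix n n ℂ) (w : FreeMonoid ι) :
    LinearMap.trace ℂ (n → ℂ) (wordRep F w) = ((w.toList.map F).prod).trace := by
  simp [wordRep, FreeMonoid.lift_apply, Matrix.toLinAlgEquiv', LinearMap.toMatrixAlgEquiv']

theorem trace_asAlgebraHom_eq {F G : ι → Matrix n n ℂ}
    (h : ∀ w : List ι, ((w.map F).prod).trace = ((w.map G).prod).trace)
    (a : MonoidAlgebra ℂ (FreeMonoid ι)) :
    LinearMap.trace ℂ _ (Algebra.lsmul ℂ ℂ (wordRep F).asModule a) =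
      LinearMap.trace ℂ _ (Algebra.lsmul ℂ ℂ (wordRep G).asModule a) := by
  change LinearMap.trace ℂ (n → ℂ) ((wordRep F).asAlgebraHom a) =
    LinearMap.trace ℂ (n → ℂ) ((wordRep G).asAlgebraHom a)
  induction a using MonoidAlgebra.induction_linear with
  | zero => simp
  | add f g hf hg => simp [hf, hg]
  | single w c => simp [Representation.asAlgebraHom_single, trace_wordRep, h]

theorem exists_orthogonal_projection (S : Submodule ℂ (n → ℂ)) :
    ∃ P : Matrix n n ℂ, P * P = P ∧ Pᴴ = P ∧ (∀ v, P *ᵥ v ∈ S) ∧ ∀ v ∈ S, P *ᵥ v = v := by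
  let K : Submodule ℂ (EuclideanSpace ℂ n) :=
    S.comap (WithLp.linearEquiv 2 ℂ (n → ℂ)).toLinearMap
  have hK := isStarProjection_starProjection (U := K)
  let e := Matrix.toEuclideanCLM (n := n) (𝕜 := ℂ)
  have he : ∀ v, e.symm K.starProjection *ᵥ v = (K.starProjection (WithLp.toLp 2 v)).ofLp := by
    intro v
    have := Matrix.ofLp_toEuclideanCLM (e.symm K.starProjection) (WithLp.toLp 2 v)
    rw [← this]
    simp [e]
  refine ⟨e.symm K.starProjection, ?_, ?_, fun v => ?_, fun v hv => ?_⟩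
  · rw [← map_mul, hK.1.eq]
  · rw [← star_eq_conjTranspose, e.eq_symm_apply, map_star e, e.apply_symm_apply,
      hK.2.star_eq]
  · rw [he]
    exact K.starProjection_apply_mem _
  · rw [he, Submodule.starProjection_eq_self_iff.mpr]
    exact hv

theorem single_one_smul_wordRep (F : ι → Matrix n n ℂ) (w : FreeMonoid ι)
    (v : (wordRep F).asModule) :
    (MonoidAlgebra.single w (1 : ℂ) • v : (wordRep F).asModule) = wordRep F w v :=
  (Representation.single_smul _ _ _ v).trans (one_smul ℂ _)

theorem isSemisimpleModule_wordRep {F : ι → Matrix n n ℂ}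
    (hF : ∀ P : Matrix n n ℂ, P * P = P → Pᴴ = P → (∀ i, P * F i * P = F i * P) →
      ∀ i, P * F i = F i * P) :
    IsSemisimpleModule (MonoidAlgebra ℂ (FreeMonoid ι)) (wordRep F).asModule := by
  refine (isSemisimpleModule_iff _ _).mpr ⟨fun S => ?_⟩
  obtain ⟨P, hP, hPH, hPS, hSP⟩ := exists_orthogonal_projection
    ((S.restrictScalars ℂ).map (wordRep F).asModuleEquiv.toLinearMap)
  have hmem : ∀ v : (wordRep F).asModule,
      v ∈ (S.restrictScalars ℂ).map (wordRep F).asModuleEquiv.toLinearMap ↔ v ∈ S :=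
    fun v => ⟨fun ⟨w, hw, hwv⟩ => hwv ▸ hw, fun hv => ⟨v, hv, rfl⟩⟩
  have hcomm : ∀ i, P * F i = F i * P := by
    refine hF P hP hPH fun i => ?_
    refine Matrix.ext_of_mulVec_single fun j => ?_
    rw [mul_assoc, ← mulVec_mulVec]
    refine hSP _ ?_
    rw [← mulVec_mulVec, ← wordRep_of]
    refine (hmem _).mpr ?_
    exact (congrArg (· ∈ S) (single_one_smul_wordRep F (.of i) _)).mp
      (S.smul_mem _ ((hmem _).mp (hPS (Pi.single j 1))))
  have hcommw : ∀ (w : FreeMonoid ι) (v : n → ℂ), P *ᵥ (wordRep F w v) = wordRep F w (P *ᵥ v) := by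
    intro w
    induction w using FreeMonoid.inductionOn' with
    | one => simp
    | of_mul i w ih =>
      intro v
      rw [map_mul, Module.End.mul_apply, Module.End.mul_apply, wordRep_of, wordRep_of, ← ih,
        mulVec_mulVec, mulVec_mulVec, hcomm]
  let p₀ : (wordRep F).asModule →ₗ[ℂ] (wordRep F).asModule := P.mulVecLin
  let p : (wordRep F).asModule →ₗ[MonoidAlgebra ℂ (FreeMonoid ι)] (wordRep F).asModule :=
    MonoidAlgebra.equivariantOfLinearOfComm
      p₀ fun w v => by
        rw [single_one_smul_wordRep, single_one_smul_wordRep]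
        exact hcommw w v
  let p' : (wordRep F).asModule →ₗ[MonoidAlgebra ℂ (FreeMonoid ι)] S :=
    p.codRestrict S fun v => (hmem _).mp (hPS v)
  exact ⟨_, LinearMap.isCompl_of_proj (f := p') fun x =>
    Subtype.ext (hSP _ ((hmem _).mpr x.2))⟩

/-- Two isomorphic matrix representations of the free monoid are simultaneously conjugate. -/
theorem exists_conj_of_wordRep_equiv {F G : ι → Matrix n n ℂ}
    (e : (wordRep F).asModule ≃ₗ[MonoidAlgebra ℂ (FreeMonoid ι)] (wordRep G).asModule) :
    ∃ T : GL n ℂ, G = fun i => (T : Matrix n n ℂ) * F i * ((T⁻¹ : GL n ℂ) : Matrix n n ℂ) := by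
  let e' : (n → ℂ) ≃ₗ[ℂ] (n → ℂ) := e.restrictScalars ℂ
  have he : ∀ i v, e' (F i *ᵥ v) = G i *ᵥ e' v := by
    intro i v
    rw [← wordRep_of, ← wordRep_of]
    exact ((congrArg e (single_one_smul_wordRep F (.of i) v)).symm.trans
      (e.map_smul (MonoidAlgebra.single (FreeMonoid.of i) (1 : ℂ)) v)).trans
      (single_one_smul_wordRep G (.of i) (e v))
  let T : GL n ℂ := ⟨LinearMap.toMatrix' e'.toLinearMap, LinearMap.toMatrix' e'.symm.toLinearMap,
    by rw [← LinearMap.toMatrix'_comp]; simp, by rw [← LinearMap.toMatrix'_comp]; simp⟩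
  have hT : ∀ v, (T : Matrix n n ℂ) *ᵥ v = e' v := fun v => LinearMap.toMatrix'_mulVec _ v
  refine ⟨T, funext fun i => ?_⟩
  rw [Units.eq_mul_inv_iff_mul_eq]
  refine Matrix.ext_of_mulVec_single fun j => ?_
  rw [← mulVec_mulVec, ← mulVec_mulVec, hT, hT, he]

end MatrixRep

section Frobenius

open Matrix

variable {n : Type*} [Fintype n]

/-- The squared Frobenius norm. -/
noncomputable def frobSq (A : Matrix n n ℂ) : ℝ := ∑ i, ∑ j, ‖A i j‖ ^ 2

theorem frobSq_nonneg (A : Matrix n n ℂ) : 0 ≤ frobSq A :=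
  Finset.sum_nonneg fun _ _ => Finset.sum_nonneg fun _ _ => by positivity

theorem sq_norm_entry_le_frobSq (A : Matrix n n ℂ) (i j : n) : ‖A i j‖ ^ 2 ≤ frobSq A :=
  (Finset.single_le_sum (f := fun j => ‖A i j‖ ^ 2) (fun _ _ => by positivity)
    (Finset.mem_univ j)).trans
  (Finset.single_le_sum (f := fun i => ∑ j, ‖A i j‖ ^ 2)
    (fun _ _ => Finset.sum_nonneg fun _ _ => by positivity) (Finset.mem_univ i))

theorem eq_zero_of_frobSq_le_zero {A : Matrix n n ℂ} (h : frobSq A ≤ 0) : A = 0 := by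
  ext i j
  have := (sq_norm_entry_le_frobSq A i j).trans h
  simpa using pow_eq_zero_iff two_ne_zero |>.mp (le_antisymm this (by positivity))

theorem frobSq_eq_trace (A : Matrix n n ℂ) : (frobSq A : ℂ) = (Aᴴ * A).trace := by
  rw [frobSq, Finset.sum_comm]
  simp [Matrix.trace, Matrix.mul_apply, Complex.conj_mul']

theorem frobSq_add_of_trace_eq_zero {A B : Matrix n n ℂ} (h : (Aᴴ * B).trace = 0) :
    frobSq (A + B) = frobSq A + frobSq B := by
  have h' : (Bᴴ * A).trace = 0 := by
    rw [← conjTranspose_conjTranspose A, ← conjTranspose_mul, trace_conjTranspose, h, star_zero]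
  have : (frobSq (A + B) : ℂ) = frobSq A + frobSq B := by
    simp only [frobSq_eq_trace, conjTranspose_add, add_mul, mul_add, trace_add, h, h']
    ring
  exact_mod_cast this

end Frobenius

section ConjOrbit

open Matrix Filter Topology

variable {ι : Type*} {n : Type*} [Fintype n] [DecidableEq n]

/-- The orbit of a family of square matrices under simultaneous conjugation. -/
def conjOrbit (F : ι → Matrix n n ℂ) : Set (ι → Matrix n n ℂ) :=
  {H | ∃ T : GL n ℂ,
    H = fun i => (T : Matrix n n ℂ) * F i * ((T⁻¹ : GL n ℂ) : Matrix n n ℂ)}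

theorem self_mem_conjOrbit (F : ι → Matrix n n ℂ) : F ∈ conjOrbit F := ⟨1, by simp⟩

theorem conj_mem_closure_conjOrbit {F H : ι → Matrix n n ℂ} (hH : H ∈ closure (conjOrbit F))
    (T : GL n ℂ) :
    (fun i => (T : Matrix n n ℂ) * H i * ((T⁻¹ : GL n ℂ) : Matrix n n ℂ)) ∈
      closure (conjOrbit F) := by
  refine map_mem_closure (f := fun H : ι → Matrix n n ℂ => fun i =>
    (T : Matrix n n ℂ) * H i * ((T⁻¹ : GL n ℂ) : Matrix n n ℂ)) (by fun_prop) hH ?_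
  rintro _ ⟨U, rfl⟩
  exact ⟨T * U, by simp [mul_assoc]⟩

theorem trace_word_conj (F : ι → Matrix n n ℂ) (T : GL n ℂ) (w : List ι) :
    ((w.map fun i => (T : Matrix n n ℂ) * F i * ((T⁻¹ : GL n ℂ) : Matrix n n ℂ)).prod).trace =
      ((w.map F).prod).trace := by
  have h : (w.map fun i => (T : Matrix n n ℂ) * F i * ((T⁻¹ : GL n ℂ) : Matrix n n ℂ)).prod =
      (T : Matrix n n ℂ) * (w.map F).prod * ((T⁻¹ : GL n ℂ) : Matrix n n ℂ) := by
    induction w with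
    | nil => simp
    | cons i w ih =>
      rw [List.map_cons, List.prod_cons, ih, List.map_cons, List.prod_cons]
      simp only [mul_assoc, Units.inv_mul_cancel_left]
  rw [h, Matrix.trace_mul_comm, ← mul_assoc, Units.inv_mul, one_mul]

theorem trace_word_eq_of_mem_closure {F H : ι → Matrix n n ℂ} (hH : H ∈ closure (conjOrbit F))
    (w : List ι) : ((w.map H).prod).trace = ((w.map F).prod).trace := by
  have hclosed : IsClosed {H : ι → Matrix n n ℂ |
      ((w.map H).prod).trace = ((w.map F).prod).trace} := by
    refine isClosed_eq (Continuous.matrix_trace ?_) continuous_const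
    exact continuous_list_prod w fun i _ => continuous_apply i
  refine closure_minimal ?_ hclosed hH
  rintro _ ⟨T, rfl⟩
  exact trace_word_conj F T w

/-- If the range of the projection `P` is invariant under every `H i`, then the block-diagonal part
of `H` relative to `P` lies in the closure of the orbit of `H`. -/
theorem blockDiag_mem_closure_conjOrbit {F H : ι → Matrix n n ℂ}
    (hH : H ∈ closure (conjOrbit F)) {P : Matrix n n ℂ} (hP : P * P = P)
    (hinv : ∀ i, P * H i * P = H i * P) :
    (fun i => P * H i * P + (1 - P) * H i * (1 - P)) ∈ closure (conjOrbit F) := by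
  let f : ℂ → ι → Matrix n n ℂ := fun t i =>
    (P * H i * P + (1 - P) * H i * (1 - P)) + t • (P * H i * (1 - P))
  have hf0 : f 0 = fun i => P * H i * P + (1 - P) * H i * (1 - P) := by
    funext i
    simp [f]
  have hfc : Continuous f := by fun_prop
  have hPQ : P * (1 - P) = 0 := by rw [mul_sub, hP, mul_one, sub_self]
  have hQP : (1 - P) * P = 0 := by rw [sub_mul, hP, one_mul, sub_self]
  have hQQ : (1 - P) * (1 - P) = 1 - P := by rw [mul_sub, hQP, mul_one, sub_zero]
  have hft : ∀ t : ℂ, t ≠ 0 → f t ∈ closure (conjOrbit F) := by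
    intro t ht
    let T : GL n ℂ := ⟨P + t⁻¹ • (1 - P), P + t • (1 - P),
      by simp [add_mul, mul_add, hP, hPQ, hQP, hQQ, ht, smul_smul],
      by simp [add_mul, mul_add, hP, hPQ, hQP, hQQ, ht]⟩
    have hT : f t = fun i => (T : Matrix n n ℂ) * H i * ((T⁻¹ : GL n ℂ) : Matrix n n ℂ) := by
      funext i
      have h0 : (1 - P) * H i * P = 0 := by
        rw [mul_assoc, ← hinv, ← mul_assoc, ← mul_assoc, hQP, zero_mul, zero_mul]
      change _ = (P + t⁻¹ • (1 - P)) * H i * (P + t • (1 - P))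
      simp only [f, add_mul, mul_add, smul_mul_assoc, mul_smul_comm, h0, smul_add, smul_zero,
        smul_smul, mul_inv_cancel₀ ht, one_smul]
      abel
    rw [hT]
    exact conj_mem_closure_conjOrbit hH T
  rw [← hf0]
  have hlim : Tendsto f (𝓝[≠] 0) (𝓝 (f 0)) := (hfc.tendsto 0).mono_left nhdsWithin_le_nhds
  exact isClosed_closure.mem_of_tendsto hlim
    (eventually_nhdsWithin_of_forall fun t ht => hft t ht)

theorem exists_frobSq_min [Fintype ι] (F : ι → Matrix n n ℂ) :
    ∃ H ∈ closure (conjOrbit F), ∀ H' ∈ closure (conjOrbit F),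
      ∑ i, frobSq (H i) ≤ ∑ i, frobSq (H' i) := by
  have hcont : Continuous fun H : ι → Matrix n n ℂ => ∑ i, frobSq (H i) := by
    unfold frobSq
    fun_prop
  set c := ∑ i, frobSq (F i)
  have hcomp : IsCompact {H : ι → Matrix n n ℂ | ∀ i a b, H i a b ∈ Metric.closedBall 0 √c} := by
    have := isCompact_univ_pi fun _ : ι => isCompact_univ_pi fun _ : n => isCompact_univ_pi
      fun _ : n => isCompact_closedBall (0 : ℂ) √c
    simpa only [Set.pi, Set.mem_univ, true_imp_iff, Set.mem_ofPred_eq] using! this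
  have hK : IsCompact (closure (conjOrbit F) ∩ {H | ∑ i, frobSq (H i) ≤ c}) := by
    refine hcomp.of_isClosed_subset
      (isClosed_closure.inter (isClosed_le hcont continuous_const)) ?_
    rintro H ⟨-, hH⟩ i a b
    rw [mem_closedBall_zero_iff]
    exact Real.le_sqrt_of_sq_le ((sq_norm_entry_le_frobSq (H i) a b).trans
      ((Finset.single_le_sum (f := fun i => frobSq (H i)) (fun _ _ => frobSq_nonneg _)
        (Finset.mem_univ i)).trans hH))
  have hF : F ∈ closure (conjOrbit F) := subset_closure (self_mem_conjOrbit F)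
  obtain ⟨H, hH, hmin⟩ := hK.exists_isMinOn ⟨F, hF, le_refl c⟩ hcont.continuousOn
  refine ⟨H, hH.1, fun H' hH' => ?_⟩
  rcases le_total (∑ i, frobSq (H' i)) c with h | h
  · exact hmin ⟨hH', h⟩
  · exact le_trans hH.2 h

/-- Every orbit closure contains a family commuting with each orthogonal projection onto an
invariant subspace. -/
theorem exists_mem_closure_conjOrbit_commute_projection [Fintype ι] (F : ι → Matrix n n ℂ) :
    ∃ H ∈ closure (conjOrbit F), ∀ P : Matrix n n ℂ, P * P = P → Pᴴ = P →
      (∀ i, P * H i * P = H i * P) → ∀ i, P * H i = H i * P := by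
  obtain ⟨H, hH, hmin⟩ := exists_frobSq_min F
  refine ⟨H, hH, fun P hP hPH hinv => ?_⟩
  have hQP : (1 - P) * P = 0 := by rw [sub_mul, hP, one_mul, sub_self]
  have hPQ : P * (1 - P) = 0 := by rw [mul_sub, hP, mul_one, sub_self]
  have hQH : (1 - P)ᴴ = 1 - P := by rw [conjTranspose_sub, conjTranspose_one, hPH]
  have hdecomp : ∀ i, H i = (P * H i * P + (1 - P) * H i * (1 - P)) + P * H i * (1 - P) := by
    intro i
    simp only [mul_sub, sub_mul, one_mul, mul_one, hinv]
    abel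
  have hpyth : ∀ i, frobSq (H i) =
      frobSq (P * H i * P + (1 - P) * H i * (1 - P)) + frobSq (P * H i * (1 - P)) := by
    intro i
    conv_lhs => rw [hdecomp i]
    refine frobSq_add_of_trace_eq_zero ?_
    have h1 : (1 - P) * (P * H i * (1 - P)) = 0 := by
      rw [← mul_assoc, ← mul_assoc, hQP, zero_mul, zero_mul]
    simp only [conjTranspose_add, conjTranspose_mul, hPH, hQH, add_mul, trace_add]
    rw [trace_mul_comm (P * _), mul_assoc (P * H i), ← mul_assoc (1 - P) P, hQP, zero_mul, mul_zero,
      mul_assoc (1 - P), mul_assoc _ (1 - P), h1, mul_zero, mul_zero, trace_zero, add_zero]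
  have hle := hmin _ (blockDiag_mem_closure_conjOrbit hH hP hinv)
  simp only [hpyth, Finset.sum_add_distrib] at hle
  intro i
  have h0 : P * H i * (1 - P) = 0 := by
    refine eq_zero_of_frobSq_le_zero ?_
    exact (Finset.single_le_sum (f := fun i => frobSq (P * H i * (1 - P)))
      (fun _ _ => frobSq_nonneg _) (Finset.mem_univ i)).trans (by linarith)
  rw [mul_sub, mul_one, sub_eq_zero] at h0
  rw [h0, hinv]

end ConjOrbit

/-- Specialization of the first main theorem (thm:main1) to families of square
matrices: equality of all word traces is equivalent to intersection of the
closures of the simultaneous-conjugation orbits. -/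
theorem stmt3 {ι : Type*} [Fintype ι] {q : ℕ} (hq : 0 < q)
    (F G : ι → Matrix (Fin q) (Fin q) ℂ) :
    (∀ w : List ι, Matrix.trace ((w.map F).prod) = Matrix.trace ((w.map G).prod)) ↔
    (closure {H : ι → Matrix (Fin q) (Fin q) ℂ | ∃ T : GL (Fin q) ℂ,
        H = fun i => (T : Matrix (Fin q) (Fin q) ℂ) * F i *
          ((T⁻¹ : GL (Fin q) ℂ) : Matrix (Fin q) (Fin q) ℂ)} ∩
      closure {H : ι → Matrix (Fin q) (Fin q) ℂ | ∃ T : GL (Fin q) ℂ,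
        H = fun i => (T : Matrix (Fin q) (Fin q) ℂ) * G i *
          ((T⁻¹ : GL (Fin q) ℂ) : Matrix (Fin q) (Fin q) ℂ)}).Nonempty := by
  change _ ↔ (closure (conjOrbit F) ∩ closure (conjOrbit G)).Nonempty
  constructor
  · intro h
    obtain ⟨F', hF', hFss⟩ := exists_mem_closure_conjOrbit_commute_projection F
    obtain ⟨G', hG', hGss⟩ := exists_mem_closure_conjOrbit_commute_projection G
    have := isSemisimpleModule_wordRep hFss
    have := isSemisimpleModule_wordRep hGss
    have htr : ∀ w : List ι, ((w.map F').prod).trace = ((w.map G').prod).trace := fun w => by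
      rw [trace_word_eq_of_mem_closure hF', trace_word_eq_of_mem_closure hG', h]
    obtain ⟨e⟩ := nonempty_linearEquiv_of_trace_lsmul_eq (k := ℂ)
      (R := MonoidAlgebra ℂ (FreeMonoid ι)) (wordRep F').asModule (wordRep G').asModule
      (trace_asAlgebraHom_eq htr)
    obtain ⟨T, hT⟩ := exists_conj_of_wordRep_equiv e
    exact ⟨G', hT ▸ conj_mem_closure_conjOrbit hF' T, hG'⟩
  · rintro ⟨H, hHF, hHG⟩ w
    rw [← trace_word_eq_of_mem_closure hHF, trace_word_eq_of_mem_closure hHG]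
end

section
/- Let ι be a finite type, q a positive natural number, and F : ι → Matrix (Fin q) (Fin q) ℂ. Then the zero family (fun i => (0 : Matrix (Fin q) (Fin q) ℂ)) lies in the topological closure of the simultaneous-conjugation orbit Orb(F) if and only if Matrix.trace ((w.map F).prod) = 0 for every nonempty word w : List ι (w ≠ []). (Specialization of the paper's Corollary cor:vanishing to families of square matrices: such a family is Bi-Holant-vanishing exactly when all nonempty word traces vanish.) -/
open Polynomial in
/-- In characteristic zero, an endomorphism all of whose positive powers have trace zero is
nilpotent. -/
theorem LinearMap.isNilpotent_of_forall_trace_pow_eq_zero {K V : Type*} [Field K] [CharZero K]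
    [AddCommGroup V] [Module K V] [FiniteDimensional K V] (f : Module.End K V)
    (h : ∀ k : ℕ, LinearMap.trace K V (f ^ (k + 1)) = 0) : IsNilpotent f := by
  have htrace (p : K[X]) : LinearMap.trace K V (aeval f (p * X)) = 0 := by
    induction p using Polynomial.induction_on' with
    | add p q hp hq => rw [add_mul, map_add, map_add, hp, hq, add_zero]
    | monomial n a =>
      rw [monomial_mul_X, aeval_monomial, Module.algebraMap_end_eq_smul_id, ← Module.End.one_eq_id,
        smul_one_mul, map_smul, h, smul_zero]
  have hχ : f.charpoly ≠ 0 := f.charpoly_monic.ne_zero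
  obtain ⟨g, hg, hgd⟩ := f.charpoly.exists_eq_pow_rootMultiplicity_mul_and_not_dvd hχ 0
  set a := f.charpoly.rootMultiplicity 0
  rw [C_0, sub_zero] at hg hgd
  have hcop : IsCoprime (X ^ (a + 1)) g :=
    ((irreducible_X.coprime_iff_not_dvd).mpr hgd).pow_left
  obtain ⟨u, v, huv⟩ := hcop
  have hker : aeval f (X ^ (a + 1) * g) = 0 := by
    rw [pow_succ', mul_assoc, ← hg, map_mul, f.aeval_self_charpoly, mul_zero]
  set e := aeval f (u * X ^ (a + 1))
  have hcompl : e + aeval f (v * g) = 1 := by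
    rw [← map_add, huv, map_one]
  have hprod : e * aeval f (v * g) = 0 := by
    rw [← map_mul, show u * X ^ (a + 1) * (v * g) = u * v * (X ^ (a + 1) * g) by ring, map_mul,
      hker, mul_zero]
  have hidem : IsIdempotentElem e := by
    have := congrArg (e * ·) hcompl
    rwa [mul_add, hprod, add_zero, mul_one] at this
  have he : e = 0 := by
    refine LinearMap.IsIdempotentElem.eq_zero_of_trace_eq_zero hidem ?_
    have := htrace (u * X ^ a)
    rwa [mul_assoc, ← pow_succ] at this
  refine ⟨a + 1, ?_⟩
  rw [he, zero_add] at hcompl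
  calc
    f ^ (a + 1) = aeval f (X ^ (a + 1) : K[X]) * aeval f (v * g) := by
      rw [hcompl, mul_one, map_pow, aeval_X]
    _ = aeval f (v * (X ^ (a + 1) * g)) := by rw [← map_mul, mul_left_comm]
    _ = 0 := by rw [map_mul, hker, mul_zero]

namespace Matrix

/-- In characteristic zero, a square matrix all of whose positive powers have trace zero is
nilpotent. -/
theorem isNilpotent_of_forall_trace_pow_eq_zero {K n : Type*} [Field K] [CharZero K]
    [Fintype n] [DecidableEq n] (A : Matrix n n K)
    (h : ∀ k : ℕ, (A ^ (k + 1)).trace = 0) : IsNilpotent A := by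
  rw [← IsNilpotent.map_iff (f := Matrix.toLinAlgEquiv' (R := K) (n := n))
    (Matrix.toLinAlgEquiv').injective]
  refine LinearMap.isNilpotent_of_forall_trace_pow_eq_zero _ fun k => ?_
  rw [← map_pow]
  exact (Matrix.trace_toLin'_eq _).trans (h k)

/-- If all nonempty words in a family of matrices have trace zero, then so do all the products
`y * F i` with `y` in the algebra generated by the family. -/
theorem trace_mul_eq_zero_of_mem_adjoin {K n ι : Type*} [Field K] [Fintype n] [DecidableEq n]
    {F : ι → Matrix n n K} (h : ∀ w : List ι, w ≠ [] → ((w.map F).prod).trace = 0)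
    {y : Matrix n n K} (hy : y ∈ Algebra.adjoin K (Set.range F)) (i : ι) :
    (y * F i).trace = 0 := by
  rw [← Subalgebra.mem_toSubmodule, Algebra.adjoin_eq_span] at hy
  induction hy using Submodule.span_induction with
  | mem x hx =>
    obtain ⟨l, hl, rfl⟩ := Submonoid.exists_list_of_mem_closure hx
    obtain ⟨w, rfl⟩ : l ∈ Set.range (List.map F) := by
      rw [Set.range_list_map]
      exact hl
    simpa using h (w ++ [i]) (by simp)
  | zero => simp
  | add x y _ _ hx hy => rw [add_mul, trace_add, hx, hy, add_zero]
  | smul c x _ hx => rw [smul_mul_assoc, trace_smul, hx, smul_zero]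

/-- If all nonempty words in a family of matrices over a field of characteristic zero have trace
zero, then all sufficiently long words vanish. -/
theorem exists_forall_length_eq_prod_eq_zero {K n ι : Type*} [Field K] [CharZero K]
    [Fintype n] [DecidableEq n] {F : ι → Matrix n n K}
    (h : ∀ w : List ι, w ≠ [] → ((w.map F).prod).trace = 0) :
    ∃ k : ℕ, ∀ w : List ι, w.length = k → (w.map F).prod = 0 := by
  let A := Algebra.adjoin K (Set.range F)
  let G (i : ι) : A := ⟨F i, Algebra.subset_adjoin ⟨i, rfl⟩⟩
  have : IsArtinianRing A := IsArtinianRing.of_finite K A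
  have hnil (y : A) (i : ι) : IsNilpotent (y * G i) := by
    have : IsNilpotent ((y * G i : A) : Matrix n n K) :=
      isNilpotent_of_forall_trace_pow_eq_zero _ fun k => by
        have := trace_mul_eq_zero_of_mem_adjoin h ((y * G i) ^ k * y).2 i
        rw [pow_succ]
        simpa [G, mul_assoc] using this
    exact (IsNilpotent.map_iff (f := A.val) Subtype.val_injective).mp this
  have hG (i : ι) : G i ∈ Ideal.jacobson (⊥ : Ideal A) := by
    refine Ideal.mem_jacobson_iff.mpr fun y => ?_
    obtain ⟨z, hz⟩ := (hnil y i).isUnit_add_one.exists_left_inv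
    refine ⟨z, ?_⟩
    rw [Ideal.mem_bot, sub_eq_zero, ← hz]
    noncomm_ring
  obtain ⟨k, hk⟩ := IsArtinianRing.isNilpotent_jacobson_bot (R := A)
  have hmem (w : List ι) : (w.map G).prod ∈ Ideal.jacobson (⊥ : Ideal A) ^ w.length := by
    induction w using List.reverseRecOn with
    | nil =>
      rw [List.length_nil, Submodule.pow_zero, Ideal.one_eq_top]
      exact Submodule.mem_top
    | append_singleton w i ih =>
      rw [List.map_append, List.prod_append, List.map_singleton, List.prod_singleton,
        List.length_append, List.length_singleton, Submodule.pow_succ]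
      exact Ideal.mul_mem_mul ih (hG i)
  refine ⟨k, fun w hw => ?_⟩
  have hw0 := hmem w
  rw [hw, hk, Ideal.zero_eq_bot, Ideal.mem_bot] at hw0
  have := congrArg A.val hw0
  rw [map_list_prod, List.map_map, map_zero] at this
  exact this

section Gram

open scoped ComplexOrder

variable {n ι : Type*} [Fintype n] [Fintype ι]

/-- The completely positive map `X ↦ s ∑ i, (F i)ᴴ X (F i)`. -/
noncomputable def scaledConj (s : ℝ) (F : ι → Matrix n n ℂ) (X : Matrix n n ℂ) : Matrix n n ℂ :=
  s • ∑ i, (F i)ᴴ * X * F i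

theorem scaledConj_posSemidef {s : ℝ} (hs : 0 ≤ s) (F : ι → Matrix n n ℂ) {X : Matrix n n ℂ}
    (hX : X.PosSemidef) : (scaledConj s F X).PosSemidef :=
  (posSemidef_sum _ fun i _ => hX.conjTranspose_mul_mul_same (F i)).smul hs

theorem scaledConj_sum {κ : Type*} (s : ℝ) (F : ι → Matrix n n ℂ) (t : Finset κ)
    (X : κ → Matrix n n ℂ) :
    scaledConj s F (∑ m ∈ t, X m) = ∑ m ∈ t, scaledConj s F (X m) := by
  simp only [scaledConj, Matrix.mul_sum, Matrix.sum_mul, Finset.smul_sum]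
  exact Finset.sum_comm

variable [DecidableEq n]

theorem conj_scaledConj_iterate_eq_zero (s : ℝ) (F : ι → Matrix n n ℂ) (X : Matrix n n ℂ) (m : ℕ)
    (A : Matrix n n ℂ) (hA : ∀ w : List ι, w.length = m → (w.map F).prod * A = 0) :
    Aᴴ * (scaledConj s F)^[m] X * A = 0 := by
  induction m generalizing A with
  | zero => simp [show A = 0 by simpa using hA [] rfl]
  | succ m ih =>
    rw [Function.iterate_succ_apply', scaledConj, mul_smul_comm, smul_mul_assoc, Matrix.mul_sum,
      Matrix.sum_mul, Finset.sum_eq_zero, smul_zero]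
    intro i _
    have := ih (F i * A) fun w hw => by
      simpa [mul_assoc] using hA (w ++ [i]) (by simp [hw])
    simpa [mul_assoc] using this

/-- If all words of length `k` vanish, there is a positive definite solution `G` of
`G = 1 + s ∑ i, (F i)ᴴ G (F i)`. -/
theorem exists_posDef_eq_one_add_scaledConj {s : ℝ} (hs : 0 ≤ s) {F : ι → Matrix n n ℂ} {k : ℕ}
    (hk : ∀ w : List ι, w.length = k → (w.map F).prod = 0) :
    ∃ G : Matrix n n ℂ, G.PosDef ∧ G = 1 + scaledConj s F G := by
  have hpos (m : ℕ) : ((scaledConj s F)^[m] 1).PosSemidef := by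
    induction m with
    | zero => exact .one
    | succ m ih =>
      rw [Function.iterate_succ_apply']
      exact scaledConj_posSemidef hs F ih
  have hzero : (scaledConj s F)^[k] 1 = 0 := by
    simpa using conj_scaledConj_iterate_eq_zero s F 1 k 1 fun w hw => by simp [hk w hw]
  set G := ∑ m ∈ Finset.range k, (scaledConj s F)^[m] 1
  have hG : G = 1 + scaledConj s F G := by
    rw [scaledConj_sum]
    simp_rw [← Function.iterate_succ_apply' (scaledConj s F)]
    have h₁ := Finset.sum_range_succ (fun m => (scaledConj s F)^[m] 1) k
    have h₂ := Finset.sum_range_succ' (fun m => (scaledConj s F)^[m] 1) k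
    rw [hzero, add_zero] at h₁
    rw [h₁, Function.iterate_zero_apply, add_comm] at h₂
    exact h₂
  refine ⟨G, ?_, hG⟩
  rw [hG]
  exact PosDef.one.add_posSemidef
    (scaledConj_posSemidef hs F (posSemidef_sum _ fun m _ => hpos m))

open scoped MatrixOrder in
/-- If all words of length `k` vanish, the family can be conjugated to one with arbitrarily small
entries. -/
theorem exists_conj_norm_entry_le {F : ι → Matrix n n ℂ} {k : ℕ}
    (hk : ∀ w : List ι, w.length = k → (w.map F).prod = 0) {ε : ℝ} (hε : 0 < ε) :
    ∃ T : GL n ℂ, ∀ i a b,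
      ‖((T : Matrix n n ℂ) * F i * ((T⁻¹ : GL n ℂ) : Matrix n n ℂ)) a b‖ ≤ ε := by
  have hs : (0 : ℝ) ≤ (ε ^ 2)⁻¹ := by positivity
  obtain ⟨G, hGpos, hG⟩ := exists_posDef_eq_one_add_scaledConj hs hk
  obtain ⟨B, hB⟩ := CStarAlgebra.nonneg_iff_eq_star_mul_self.mp hGpos.posSemidef.nonneg
  have hBu : IsUnit B := by
    have := hGpos.isUnit
    rw [hB, isUnit_iff_isUnit_det, det_mul] at this
    exact (isUnit_iff_isUnit_det B).mpr (isUnit_of_mul_isUnit_right this)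
  obtain ⟨T, rfl⟩ := hBu
  refine ⟨T, fun i a b => ?_⟩
  set S : Matrix n n ℂ := ((T⁻¹ : GL n ℂ) : Matrix n n ℂ)
  have hTS : (T : Matrix n n ℂ) * S = 1 := T.mul_inv
  set M := (T : Matrix n n ℂ) * F i * S
  have hle : (G - (ε ^ 2)⁻¹ • ((F i)ᴴ * G * F i)).PosSemidef := by
    classical
    have hrest : G - (ε ^ 2)⁻¹ • ((F i)ᴴ * G * F i) =
        1 + (ε ^ 2)⁻¹ • ∑ j ∈ Finset.univ.erase i, (F j)ᴴ * G * F j := by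
      have hsum := Finset.add_sum_erase Finset.univ (fun j => (F j)ᴴ * G * F j)
        (Finset.mem_univ i)
      nth_rw 1 [hG]
      rw [scaledConj, ← hsum, smul_add]
      abel
    rw [hrest]
    exact PosSemidef.one.add <| (posSemidef_sum _ fun j _ =>
      hGpos.posSemidef.conjTranspose_mul_mul_same (F j)).smul hs
  have hM : (1 - (ε ^ 2)⁻¹ • (Mᴴ * M)).PosSemidef := by
    have h := hle.conjTranspose_mul_mul_same S
    have h₁ : Sᴴ * G * S = 1 := by
      rw [hB, star_eq_conjTranspose, ← mul_assoc, ← conjTranspose_mul, hTS, mul_assoc, hTS]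
      simp
    have h₂ : Sᴴ * ((F i)ᴴ * G * F i) * S = Mᴴ * M := by
      simp only [M, hB, star_eq_conjTranspose, conjTranspose_mul, mul_assoc]
    rwa [Matrix.mul_sub, Matrix.sub_mul, h₁, mul_smul_comm, smul_mul_assoc, h₂] at h
  have hdiag := hM.diag_nonneg (i := b)
  have hMM : (Mᴴ * M) b b = ((∑ c, ‖M c b‖ ^ 2 : ℝ) : ℂ) := by
    simp [Matrix.mul_apply, ← Complex.conj_mul']
  rw [sub_apply, smul_apply, one_apply_eq, hMM, Complex.real_smul, ← Complex.ofReal_mul,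
    ← Complex.ofReal_one, ← Complex.ofReal_sub, Complex.zero_le_real, sub_nonneg,
    inv_mul_le_one₀ (by positivity)] at hdiag
  have hab : ‖M a b‖ ^ 2 ≤ ∑ c, ‖M c b‖ ^ 2 :=
    Finset.single_le_sum (f := fun c => ‖M c b‖ ^ 2) (fun c _ => by positivity)
      (Finset.mem_univ a)
  exact (pow_le_pow_iff_left₀ (norm_nonneg _) hε.le two_ne_zero).mp (hab.trans hdiag)

end Gram

theorem trace_word_conj {K n ι : Type*} [CommRing K] [Fintype n] [DecidableEq n]
    (F : ι → Matrix n n K) (T : GL n K) (w : List ι) :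
    ((w.map fun i => (T : Matrix n n K) * F i * ((T⁻¹ : GL n K) : Matrix n n K)).prod).trace =
      ((w.map F).prod).trace := by
  have h : (w.map fun i => (T : Matrix n n K) * F i * ((T⁻¹ : GL n K) : Matrix n n K)).prod =
      (T : Matrix n n K) * (w.map F).prod * ((T⁻¹ : GL n K) : Matrix n n K) := by
    induction w with
    | nil => simp
    | cons i w ih =>
      rw [List.map_cons, List.prod_cons, ih, List.map_cons, List.prod_cons]
      simp only [mul_assoc, Units.inv_mul_cancel_left]
  rw [h, trace_mul_comm, ← mul_assoc, Units.inv_mul, one_mul]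

end Matrix

/-- Specialization of Corollary cor:vanishing to families of square matrices:
the zero family lies in the orbit closure iff all nonempty word traces vanish. -/
theorem stmt4 {ι : Type*} [Fintype ι] {q : ℕ} (hq : 0 < q)
    (F : ι → Matrix (Fin q) (Fin q) ℂ) :
    ((fun _ : ι => (0 : Matrix (Fin q) (Fin q) ℂ)) ∈
      closure {H : ι → Matrix (Fin q) (Fin q) ℂ | ∃ T : GL (Fin q) ℂ,
        H = fun i => (T : Matrix (Fin q) (Fin q) ℂ) * F i *
          ((T⁻¹ : GL (Fin q) ℂ) : Matrix (Fin q) (Fin q) ℂ)}) ↔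
    (∀ w : List ι, w ≠ [] → Matrix.trace ((w.map F).prod) = 0) := by
  constructor
  · intro h w hw
    have hcont : Continuous fun H : ι → Matrix (Fin q) (Fin q) ℂ => ((w.map H).prod).trace :=
      (continuous_list_prod w fun i _ => continuous_apply i).matrix_trace
    have hclosed : IsClosed {H : ι → Matrix (Fin q) (Fin q) ℂ |
        ((w.map H).prod).trace = ((w.map F).prod).trace} :=
      isClosed_eq hcont continuous_const
    have h0 := closure_minimal (by
      rintro _ ⟨T, rfl⟩
      exact Matrix.trace_word_conj F T w) hclosed h
    obtain ⟨i, w, rfl⟩ := List.exists_cons_of_ne_nil hw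
    simpa using h0.symm
  · intro h
    obtain ⟨k, hk⟩ := Matrix.exists_forall_length_eq_prod_eq_zero h
    choose T hT using fun m : ℕ =>
      Matrix.exists_conj_norm_entry_le hk (Nat.one_div_pos_of_nat (α := ℝ) (n := m))
    refine mem_closure_of_tendsto (f := fun m : ℕ => fun i =>
      (T m : Matrix (Fin q) (Fin q) ℂ) * F i *
        (((T m)⁻¹ : GL (Fin q) ℂ) : Matrix (Fin q) (Fin q) ℂ)) (b := Filter.atTop) ?_
      (Filter.Eventually.of_forall fun m => ⟨T m, rfl⟩)
    refine tendsto_pi_nhds.mpr fun i => tendsto_pi_nhds.mpr fun a => tendsto_pi_nhds.mpr fun b => ?_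
    exact squeeze_zero_norm (fun m => hT m i a b) tendsto_one_div_add_atTop_nhds_zero_nat
end

section
/- Let ι be a finite type and q a positive natural number. Let P : MvPolynomial (ι × Fin q × Fin q) ℂ be a polynomial in the matrix entries that is invariant under simultaneous conjugation: for every T : GL (Fin q) ℂ and every family F : ι → Matrix (Fin q) (Fin q) ℂ, evaluating P at the entries of (fun i => ↑T * F i * ↑(T⁻¹)) gives the same value as evaluating P at the entries of F. Then there exist m : ℕ, coefficients c : Fin m → ℂ, and lists of words W : Fin m → List (List ι) such that for every family F : ι → Matrix (Fin q) (Fin q) ℂ, the evaluation of P at the entries of F equals ∑ k, c k * ∏ w ∈ W k, Matrix.trace ((w.map F).prod). (Specialization of the paper's Theorem thm:poly_fft to mixed binary signatures: every GL_q-invariant polynomial on matrix tuples is a linear combination of products of traces of words.) -/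
namespace TraceInvariants

open Matrix MvPolynomial
open scoped ComplexOrder

/-- The exponent vector of the monomial `∏ k, X (a k)`. -/
noncomputable def expo {κ E : Type*} [Fintype κ] (a : κ → E) : E →₀ ℕ :=
  ∑ k, Finsupp.single (a k) 1

lemma prod_X_eq_monomial {κ E : Type*} [Fintype κ] (a : κ → E) :
    ∏ k, (X (a k) : MvPolynomial E ℂ) = monomial (expo a) 1 := by
  simp [expo, X, monomial_sum_one]

lemma expo_apply {κ E : Type*} [Fintype κ] [DecidableEq E] (a : κ → E) (e : E) :
    expo a e = Fintype.card {k // a k = e} := by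
  simp [expo, Finsupp.single_apply, Fintype.card_subtype]

lemma exists_perm_of_expo_eq {κ E : Type*} [Fintype κ] {a b : κ → E}
    (h : expo a = expo b) : ∃ σ : Equiv.Perm κ, b = a ∘ σ := by
  classical
  have hcard : ∀ e, Nonempty ({k // b k = e} ≃ {k // a k = e}) := fun e =>
    Fintype.card_eq.mp ((expo_apply b e).symm.trans (h ▸ expo_apply a e))
  let f := fun e => (hcard e).some
  refine ⟨(Equiv.sigmaFiberEquiv b).symm.trans
    ((Equiv.sigmaCongrRight f).trans (Equiv.sigmaFiberEquiv a)), ?_⟩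
  funext k
  exact (f (b k) ⟨k, rfl⟩).2.symm

lemma exists_expo_eq {E : Type*} {d : ℕ} (m : E →₀ ℕ) (hm : m.degree = d) :
    ∃ a : Fin d → E, expo a = m := by
  classical
  have hlen : m.toMultiset.toList.length = d := by
    rw [Multiset.length_toList, Finsupp.card_toMultiset, ← hm]; rfl
  subst hlen
  refine ⟨m.toMultiset.toList.get, ?_⟩
  apply (Multiset.toFinsupp (α := E)).symm.injective
  change Finsupp.toMultiset _ = Finsupp.toMultiset _
  rw [expo, Finsupp.toMultiset_sum]
  simp only [Finsupp.toMultiset_single, one_smul]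
  rw [← List.sum_ofFn, ← Function.comp_def (fun e : E => ({e} : Multiset E)), ← List.map_ofFn,
    List.ofFn_get, ← Multiset.sum_coe, ← Multiset.map_coe, Multiset.coe_toList,
    Multiset.sum_map_singleton]

/-- A coefficient tensor pairing to zero with all tensor powers `x ⊗ ⋯ ⊗ x`, for `x` outside the
zero locus of a nonzero polynomial, pairs to zero with every symmetric tensor. -/
lemma sum_mul_symmetric_eq_zero {κ E : Type*} [Fintype κ] [Fintype E] [DecidableEq κ]
    {D : MvPolynomial E ℂ} (hD : D ≠ 0) {c B : (κ → E) → ℂ}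
    (hc : ∀ x : E → ℂ, eval x D ≠ 0 → ∑ a, c a * ∏ k, x (a k) = 0)
    (hB : ∀ (a : κ → E) (σ : Equiv.Perm κ), B (a ∘ σ) = B a) :
    ∑ a, c a * B a = 0 := by
  classical
  have hpoly : ∑ a : κ → E, monomial (expo a) (c a) = (0 : MvPolynomial E ℂ) := by
    have key : D * ∑ a : κ → E, monomial (expo a) (c a) = 0 := by
      apply MvPolynomial.funext
      intro x
      rw [map_mul, map_zero, mul_eq_zero, or_iff_not_imp_left]
      intro hx
      rw [← hc x hx, map_sum]
      refine Finset.sum_congr rfl fun a _ => ?_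
      rw [← mul_one (c a), ← C_mul_monomial, ← prod_X_eq_monomial]
      simp
    exact (mul_eq_zero.mp key).resolve_left hD
  rw [← Finset.sum_fiberwise_of_maps_to (g := expo) (t := Finset.univ.image expo)
    (fun a _ => Finset.mem_image_of_mem _ (Finset.mem_univ a))]
  refine Finset.sum_eq_zero fun m hm => ?_
  obtain ⟨b, -, rfl⟩ := Finset.mem_image.mp hm
  have hcoeff := congrArg (coeff (expo b)) hpoly
  rw [coeff_sum] at hcoeff
  simp only [coeff_monomial, coeff_zero] at hcoeff
  rw [← Finset.sum_filter] at hcoeff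
  rw [← zero_mul (B b), ← hcoeff, Finset.sum_mul]
  refine Finset.sum_congr rfl fun a ha => ?_
  obtain ⟨σ, rfl⟩ := exists_perm_of_expo_eq (Finset.mem_filter.mp ha).2
  rw [hB]

lemma expo_comp_perm {κ E : Type*} [Fintype κ] (a : κ → E) (σ : Equiv.Perm κ) :
    expo (a ∘ σ) = expo a :=
  Equiv.sum_comp σ fun k => Finsupp.single (a k) 1

/-- A homogeneous polynomial is the restriction to the diagonal of a symmetric multilinear form. -/
lemma exists_symmetric_tensor {E : Type*} [Fintype E] {d : ℕ} {P : MvPolynomial E ℂ}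
    (hP : P.IsHomogeneous d) :
    ∃ c : (Fin d → E) → ℂ, (∀ a (σ : Equiv.Perm (Fin d)), c (a ∘ σ) = c a) ∧
      ∀ x : E → ℂ, eval x P = ∑ a, c a * ∏ k, x (a k) := by
  classical
  let fib : (E →₀ ℕ) → Finset (Fin d → E) := fun m => {a | expo a = m}
  refine ⟨fun a => coeff (expo a) P / (fib (expo a)).card,
    fun a σ => by simp only [expo_comp_perm], fun x => ?_⟩
  have hx : ∀ a : Fin d → E, ∏ k, x (a k) = ∏ i ∈ (expo a).support, x i ^ expo a i := by
    intro a
    have := congrArg (eval x) (prod_X_eq_monomial a)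
    simpa [eval_monomial, Finsupp.prod] using this
  rw [← Finset.sum_fiberwise_of_maps_to (g := expo)
    (t := P.support ∪ Finset.univ.image (expo : (Fin d → E) → _))
    (fun a _ => Finset.mem_union_right _ (Finset.mem_image_of_mem _ (Finset.mem_univ a))),
    eval_eq, Finset.sum_subset Finset.subset_union_left]
  · refine Finset.sum_congr rfl fun m hm => ?_
    have hne : (fib m).Nonempty := by
      rcases Finset.mem_union.mp hm with h | h
      · obtain ⟨a, ha⟩ := exists_expo_eq m
          (by by_contra hd; exact mem_support_iff.mp h (hP.coeff_eq_zero hd))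
        exact ⟨a, by simp [fib, ha]⟩
      · obtain ⟨a, -, ha⟩ := Finset.mem_image.mp h
        exact ⟨a, by simp [fib, ha]⟩
    have hcard : ((fib m).card : ℂ) ≠ 0 := by exact_mod_cast hne.card_pos.ne'
    rw [Finset.sum_congr rfl (g := fun _ => coeff m P / (fib m).card *
      ∏ i ∈ m.support, x i ^ m i)]
    · rw [Finset.sum_const, nsmul_eq_mul]
      change _ = ((fib m).card : ℂ) * _
      field_simp
    · intro a ha
      obtain rfl := (Finset.mem_filter.mp ha).2
      rw [hx]
  · intro m _ hm
    rw [notMem_support_iff.mp hm, zero_mul]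

/-- Double centralizer theorem for a representation of a finite group. -/
lemma exists_eq_sum_of_commute_commutant {G N : Type*} [Group G] [Fintype G] [Fintype N]
    [DecidableEq N] (R : G →* Matrix N N ℂ) (A : Matrix N N ℂ)
    (hA : ∀ B : Matrix N N ℂ, (∀ g, R g * B = B * R g) → A * B = B * A) :
    ∃ c : G → ℂ, A = ∑ g, c g • R g := by
  let S : Submodule ℂ (Matrix N N ℂ) := Submodule.span ℂ (Set.range R)
  obtain ⟨p, hp⟩ := S.subtype.exists_leftInverse_of_injective S.ker_subtype
  have hp' : ∀ g, (p (R g) : Matrix N N ℂ) = R g := fun g =>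
    congrArg Subtype.val (LinearMap.congr_fun hp ⟨R g, Submodule.subset_span ⟨g, rfl⟩⟩)
  let π : Matrix N N ℂ →ₗ[ℂ] Matrix N N ℂ :=
    ∑ g : G, LinearMap.mulLeft ℂ (R g⁻¹) ∘ₗ S.subtype ∘ₗ p ∘ₗ LinearMap.mulLeft ℂ (R g)
  have hπ : ∀ Y, π Y = ∑ g : G, R g⁻¹ * (p (R g * Y) : Matrix N N ℂ) := by
    intro Y; simp [π, LinearMap.sum_apply]
  have hequiv : ∀ h Y, π (R h * Y) = R h * π Y := by
    intro h Y
    rw [hπ, hπ, Finset.mul_sum, ← Equiv.sum_comp (Equiv.mulRight h)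
      fun g => R h * (R g⁻¹ * (p (R g * Y) : Matrix N N ℂ))]
    refine Finset.sum_congr rfl fun g _ => ?_
    simp only [Equiv.coe_mulRight, ← mul_assoc, ← map_mul]
    simp
  have hone : π 1 = (Fintype.card G : ℂ) • 1 := by
    rw [hπ]
    simp only [mul_one, hp', ← map_mul, inv_mul_cancel, map_one]
    simp [Nat.cast_smul_eq_nsmul]
  have hmem : ∀ Y, π Y ∈ S := by
    intro Y
    rw [hπ]
    refine Submodule.sum_mem _ fun g _ => ?_
    have : S ≤ S.comap (LinearMap.mulLeft ℂ (R g⁻¹)) := by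
      refine Submodule.span_le.mpr ?_
      rintro _ ⟨h, rfl⟩
      exact Submodule.subset_span ⟨g⁻¹ * h, map_mul _ _ _⟩
    exact this (p (R g * Y)).2
  let B : N → N → Matrix N N ℂ := fun j l => of fun i k => π (single k l 1) i j
  have hB : ∀ (Y : Matrix N N ℂ) (i j k l : N), π (Y * single k l 1) i j = (B j l * Y) i k := by
    intro Y i j k l
    have : Y * single k l (1 : ℂ) = ∑ m, Y m k • single m l 1 := by
      ext a b
      simp [Matrix.mul_apply, Matrix.sum_apply, single_apply, ite_and]
    rw [this, map_sum, Matrix.sum_apply, Matrix.mul_apply]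
    exact Finset.sum_congr rfl fun m _ => by
      rw [map_smul, Matrix.smul_apply, smul_eq_mul, mul_comm]; rfl
  have hB' : ∀ (Y : Matrix N N ℂ) (i j k l : N), (Y * π (single k l 1)) i j = (Y * B j l) i k := by
    intro Y i j k l
    simp [B, Matrix.mul_apply]
  have hcomm : ∀ j l, A * B j l = B j l * A := fun j l => hA _ fun g => by
    ext i k
    rw [← hB, ← hB', hequiv]
  have hAπ : π ∘ₗ LinearMap.mulLeft ℂ A = LinearMap.mulLeft ℂ A ∘ₗ π := by
    refine Matrix.ext_linearMap _ fun k l => ?_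
    ext i j
    simpa [hB, hB'] using congrFun₂ (hcomm j l).symm i k
  have hA1 : (Fintype.card G : ℂ) • A = π A := by
    simpa [hone] using (LinearMap.congr_fun hAπ 1).symm
  have hAS : A ∈ S := by
    have := S.smul_mem ((Fintype.card G : ℂ)⁻¹) (hmem A)
    rwa [← hA1, smul_smul, inv_mul_cancel₀ (by simp), one_smul] at this
  obtain ⟨c, hc⟩ := (Submodule.mem_span_range_iff_exists_fun ℂ).mp hAS
  exact ⟨c, hc.symm⟩

/-- The Kronecker product of a family of matrices. -/
def tensorProd {κ n : Type*} [Fintype κ] (M : κ → Matrix n n ℂ) : Matrix (κ → n) (κ → n) ℂ :=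
  of fun I J => ∏ k, M k (I k) (J k)

lemma tensorProd_mul {κ n : Type*} [Fintype κ] [DecidableEq κ] [Fintype n]
    (M M' : κ → Matrix n n ℂ) :
    tensorProd M * tensorProd M' = tensorProd fun k => M k * M' k := by
  ext I J
  simp only [tensorProd, Matrix.mul_apply, of_apply, ← Finset.prod_mul_distrib]
  rw [Finset.prod_univ_sum, Fintype.piFinset_univ]

lemma tensorProd_one {κ n : Type*} [Fintype κ] [DecidableEq n] :
    tensorProd (fun _ : κ => (1 : Matrix n n ℂ)) = 1 := by
  ext I J
  simp [tensorProd, Matrix.one_apply, Finset.prod_ite_zero, funext_iff]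

/-- The action of the symmetric group on a tensor power by permuting the factors. -/
def permRep (κ n : Type*) [Fintype κ] [DecidableEq κ] [Fintype n] [DecidableEq n] :
    Equiv.Perm κ →* Matrix (κ → n) (κ → n) ℂ where
  toFun σ := of fun I J => if J = I ∘ σ then 1 else 0
  map_one' := by
    ext I J
    simp [Matrix.one_apply, eq_comm]
  map_mul' σ τ := by
    ext I J
    rw [Matrix.mul_apply, Finset.sum_eq_single (I ∘ σ)]
    · simp only [of_apply, if_true, one_mul]
      rfl
    · intro K _ hK
      simp [hK]
    · simp

lemma permRep_apply {κ n : Type*} [Fintype κ] [DecidableEq κ] [Fintype n] [DecidableEq n]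
    (σ : Equiv.Perm κ) (I J : κ → n) :
    permRep κ n σ I J = if J = I ∘ σ then 1 else 0 := rfl

/-- A matrix commuting with all tensor powers of invertible matrices is a linear combination of
permutations of the tensor factors. -/
lemma exists_eq_sum_permRep {κ n : Type*} [Fintype κ] [DecidableEq κ] [Fintype n] [DecidableEq n]
    (A : Matrix (κ → n) (κ → n) ℂ)
    (hA : ∀ T : GL n ℂ, A * tensorProd (fun _ => (T : Matrix n n ℂ)) =
      tensorProd (fun _ => (T : Matrix n n ℂ)) * A) :
    ∃ c : Equiv.Perm κ → ℂ, A = ∑ σ, c σ • permRep κ n σ := by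
  refine exists_eq_sum_of_commute_commutant _ A fun B hB => ?_
  have hBsymm : ∀ (σ : Equiv.Perm κ) I L, B (I ∘ σ) (L ∘ σ) = B I L := by
    intro σ I L
    have h := congrFun₂ (hB σ) I (L ∘ σ)
    simpa [Matrix.mul_apply, permRep_apply, σ.surjective.injective_comp_right.eq_iff] using h
  ext I L
  let e := Equiv.arrowProdEquivProdArrow κ (fun _ => n) (fun _ => n)
  let c : (κ → n × n) → ℂ := fun a =>
    A I (e a).1 * (if (e a).2 = L then 1 else 0) - (if (e a).1 = I then 1 else 0) * A (e a).2 L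
  have hc : ∀ Y : Matrix (κ → n) (κ → n) ℂ,
      ∑ a, c a * Y (e a).1 (e a).2 = (A * Y) I L - (Y * A) I L := by
    intro Y
    rw [← e.symm.sum_comp]
    simp only [c, Equiv.apply_symm_apply, sub_mul, Finset.sum_sub_distrib, Matrix.mul_apply]
    congr 1
    · rw [Fintype.sum_prod_type]
      simp
    · rw [Fintype.sum_prod_type_right]
      simp [mul_comm]
  rw [← sub_eq_zero, ← hc]
  refine sum_mul_symmetric_eq_zero (det_mvPolynomialX_ne_zero n ℂ) (fun x hx => ?_)
    fun a σ => hBsymm σ (e a).1 (e a).2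
  rw [eval_det_mvPolynomialX] at hx
  have hT := hA (GeneralLinearGroup.mkOfDetNeZero _ hx)
  refine (hc (tensorProd fun _ => of fun i j => x (i, j))).trans (sub_eq_zero.mpr ?_)
  exact congrFun₂ hT I L

/-- Contracting a tensor product of words along a permutation of the factors gives a product of
traces of words. -/
lemma exists_words_contraction {ι n : Type*} [Fintype n] [DecidableEq n]
    (κ : Type*) [Fintype κ] :
    ∀ [DecidableEq κ] (σ : Equiv.Perm κ) (w : κ → List ι), ∃ W : List (List ι),
      ∀ F : ι → Matrix n n ℂ,
        ∑ I : κ → n, ∏ k, ((w k).map F).prod (I (σ k)) (I k) =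
          (W.map fun v => Matrix.trace (v.map F).prod).prod := by
  refine Fintype.induction_empty_option (P := fun κ _ =>
    ∀ [DecidableEq κ] (σ : Equiv.Perm κ) (w : κ → List ι), ∃ W : List (List ι),
      ∀ F : ι → Matrix n n ℂ,
        ∑ I : κ → n, ∏ k, ((w k).map F).prod (I (σ k)) (I k) =
          (W.map fun v => Matrix.trace (v.map F).prod).prod) ?_ ?_ ?_ κ
  · intro α β _ e ih _ σ w
    let _ := Fintype.ofEquiv β e.symm
    classical
    obtain ⟨W, hW⟩ := ih ((e.trans σ).trans e.symm) (w ∘ e)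
    refine ⟨W, fun F => ?_⟩
    rw [← hW, ← (e.arrowCongr (Equiv.refl n)).sum_comp]
    refine Finset.sum_congr rfl fun I _ => ?_
    rw [← e.prod_comp]
    simp
  · exact fun _ _ => ⟨[], by simp⟩
  · intro α _ ih _ σ w
    classical
    by_cases hσ : σ none = none
    · have hsome : ∀ k, some (Equiv.removeNone σ k) = σ (some k) := fun k =>
        Equiv.removeNone_some _ (Option.ne_none_iff_exists'.mp fun h => by
          simpa using σ.injective (h.trans hσ.symm))
      obtain ⟨W, hW⟩ := ih (Equiv.removeNone σ) (w ∘ some)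
      refine ⟨w none :: W, fun F => ?_⟩
      rw [List.map_cons, List.prod_cons, ← hW, Matrix.trace, Finset.sum_mul_sum,
        ← (Equiv.piOptionEquivProd (β := fun _ : Option α => n)).symm.sum_comp,
        Fintype.sum_prod_type]
      refine Finset.sum_congr rfl fun i _ => Finset.sum_congr rfl fun I _ => ?_
      simp [Fintype.prod_option, hσ, ← hsome]
    · obtain ⟨k₀, hk₀⟩ : ∃ k₀, σ (some k₀) = none := by
        obtain ⟨x, hx⟩ := σ.surjective none
        cases x with
        | none => exact absurd hx hσ
        | some k => exact ⟨k, hx⟩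
      have hne : ∀ k, k ≠ k₀ → some (Equiv.removeNone σ k) = σ (some k) := fun k hk =>
        Equiv.removeNone_some _ (Option.ne_none_iff_exists'.mp fun h => hk
          (Option.some_injective _ (σ.injective (h.trans hk₀.symm))))
      have heq : some (Equiv.removeNone σ k₀) = σ none := Equiv.removeNone_none _ hk₀
      obtain ⟨W, hW⟩ := ih (Equiv.removeNone σ)
        (Function.update (w ∘ some) k₀ (w none ++ w (some k₀)))
      refine ⟨W, fun F => ?_⟩
      rw [← hW, ← (Equiv.piOptionEquivProd (β := fun _ : Option α => n)).symm.sum_comp,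
        Fintype.sum_prod_type_right]
      refine Finset.sum_congr rfl fun I _ => ?_
      rw [← Finset.mul_prod_erase _ _ (Finset.mem_univ k₀)]
      simp only [Function.update_self, List.map_append, List.prod_append, Matrix.mul_apply,
        Finset.sum_mul]
      refine Finset.sum_congr rfl fun i _ => ?_
      rw [Fintype.prod_option, ← Finset.mul_prod_erase _ _ (Finset.mem_univ k₀), ← mul_assoc]
      congr 1
      · simp [← heq, hk₀]
      · refine Finset.prod_congr rfl fun k hk => ?_
        have hk' := Finset.ne_of_mem_erase hk
        simp [← hne k hk', hk']

/-- The contraction of a family of coefficient matrices with the tensor products of matrix words. -/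
def contraction {ι κ n : Type*} [Fintype ι] [Fintype κ] [DecidableEq κ] [Fintype n]
    (A : (κ → ι) → Matrix (κ → n) (κ → n) ℂ) (F : ι → Matrix n n ℂ) : ℂ :=
  ∑ s, Matrix.trace (A s * tensorProd (F ∘ s))

/-- The identification of tensors over `ι × n × n` with families of matrices. -/
def tensorIndexEquiv (ι κ n : Type*) :
    (κ → ι × n × n) ≃ (κ → ι) × (κ → n) × (κ → n) :=
  (Equiv.arrowProdEquivProdArrow κ (fun _ => ι) (fun _ => n × n)).trans
    ((Equiv.refl _).prodCongr (Equiv.arrowProdEquivProdArrow κ (fun _ => n) (fun _ => n)))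

lemma sum_tensor_eq_contraction {ι κ n : Type*} [Fintype ι] [Fintype κ] [DecidableEq κ]
    [Fintype n] (A : (κ → ι) → Matrix (κ → n) (κ → n) ℂ) (F : ι → Matrix n n ℂ) :
    ∑ a : κ → ι × n × n, A (fun k => (a k).1) (fun k => (a k).2.2) (fun k => (a k).2.1) *
      ∏ k, F (a k).1 (a k).2.1 (a k).2.2 = contraction A F := by
  rw [← (tensorIndexEquiv ι κ n).symm.sum_comp, Fintype.sum_prod_type]
  refine Finset.sum_congr rfl fun s _ => ?_
  rw [Fintype.sum_prod_type_right]
  rfl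

/-- An equivariant family of coefficient matrices is determined by its contraction. -/
lemma eq_zero_of_contraction_eq_zero {ι κ n : Type*} [Fintype ι] [Fintype κ] [DecidableEq κ]
    [Fintype n] {A : (κ → ι) → Matrix (κ → n) (κ → n) ℂ}
    (hsymm : ∀ (σ : Equiv.Perm κ) s I J, A (s ∘ σ) (I ∘ σ) (J ∘ σ) = A s I J)
    (h : ∀ F, contraction A F = 0) : A = 0 := by
  let c : (κ → ι × n × n) → ℂ := fun a =>
    A (fun k => (a k).1) (fun k => (a k).2.2) (fun k => (a k).2.1)
  have hc : ∑ a, c a * star (c a) = 0 := by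
    refine sum_mul_symmetric_eq_zero (one_ne_zero (α := MvPolynomial (ι × n × n) ℂ))
      (fun x _ => ?_) fun a σ => congrArg star (hsymm σ
        (fun k => (a k).1) (fun k => (a k).2.2) fun k => (a k).2.1)
    exact (sum_tensor_eq_contraction A fun i => of fun j k => x (i, j, k)).trans (h _)
  have hc0 : c = 0 := dotProduct_self_star_eq_zero.mp hc
  funext s
  ext J I
  exact congrFun hc0 fun k => (s k, I k, J k)

/-- The product of the traces of the words in a list. -/
def traceMonomial {ι n : Type*} [Fintype n] [DecidableEq n] (W : List (List ι))
    (F : ι → Matrix n n ℂ) : ℂ :=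
  (W.map fun w => Matrix.trace (w.map F).prod).prod

lemma trace_permRep_mul_mem_span {ι κ n : Type*} [Fintype κ] [DecidableEq κ] [Fintype n]
    [DecidableEq n] (σ : Equiv.Perm κ) (s : κ → ι) :
    (fun F : ι → Matrix n n ℂ => Matrix.trace (permRep κ n σ * tensorProd (F ∘ s))) ∈
      Submodule.span ℂ (Set.range traceMonomial) := by
  obtain ⟨W, hW⟩ := exists_words_contraction (n := n) κ σ fun k => [s k]
  refine Submodule.subset_span ⟨W, funext fun F => ?_⟩
  rw [traceMonomial, ← hW, Matrix.trace]
  refine Finset.sum_congr rfl fun I _ => ?_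
  simp only [List.map_cons, List.map_nil, List.prod_cons, List.prod_nil, mul_one, Matrix.diag_apply]
  simp [Matrix.mul_apply, permRep_apply, tensorProd]

lemma homogeneous_mem_span {ι n : Type*} [Fintype ι] [Fintype n] [DecidableEq n] {d : ℕ}
    {P : MvPolynomial (ι × n × n) ℂ} (hP : P.IsHomogeneous d)
    (hinv : ∀ (T : GL n ℂ) (F : ι → Matrix n n ℂ),
      eval (fun v => ((T : Matrix n n ℂ) * F v.1 * ((T⁻¹ : GL n ℂ) : Matrix n n ℂ)) v.2.1 v.2.2) P =
        eval (fun v => F v.1 v.2.1 v.2.2) P) :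
    (fun F : ι → Matrix n n ℂ => eval (fun v => F v.1 v.2.1 v.2.2) P) ∈
      Submodule.span ℂ (Set.range traceMonomial) := by
  obtain ⟨c, hsymm, hc⟩ := exists_symmetric_tensor hP
  let A : (Fin d → ι) → Matrix (Fin d → n) (Fin d → n) ℂ := fun s => of fun J I =>
    c fun k => (s k, I k, J k)
  have hA : ∀ F : ι → Matrix n n ℂ, eval (fun v => F v.1 v.2.1 v.2.2) P = contraction A F :=
    fun F => (hc _).trans (sum_tensor_eq_contraction A F)
  have hAsymm : ∀ (σ : Equiv.Perm (Fin d)) s I J, A (s ∘ σ) (I ∘ σ) (J ∘ σ) = A s I J :=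
    fun σ s I J => hsymm (fun k => (s k, J k, I k)) σ
  have hcomm : ∀ (T : GL n ℂ) s, A s * tensorProd (fun _ => (T : Matrix n n ℂ)) =
      tensorProd (fun _ => (T : Matrix n n ℂ)) * A s := by
    intro T
    let U : Matrix (Fin d → n) (Fin d → n) ℂ := tensorProd fun _ => (T : Matrix n n ℂ)
    let V : Matrix (Fin d → n) (Fin d → n) ℂ :=
      tensorProd fun _ => ((T⁻¹ : GL n ℂ) : Matrix n n ℂ)
    have hUV : U * V = 1 := by
      simp only [U, V, tensorProd_mul, ← Units.val_mul, mul_inv_cancel, Units.val_one,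
        tensorProd_one]
    let A' : (Fin d → ι) → Matrix (Fin d → n) (Fin d → n) ℂ := fun s => V * A s * U
    have hA'symm : ∀ (σ : Equiv.Perm (Fin d)) s I J,
        A' (s ∘ σ) (I ∘ σ) (J ∘ σ) = A' s I J := by
      intro σ s I J
      let e : (Fin d → n) ≃ (Fin d → n) := σ.symm.arrowCongr (Equiv.refl n)
      have hpow : ∀ M : Matrix n n ℂ,
          (tensorProd fun _ : Fin d => M).submatrix e e = tensorProd fun _ => M := fun M => by
        ext I J
        exact Equiv.prod_comp σ fun k => M (I k) (J k)
      have hAe : (A (s ∘ σ)).submatrix e e = A s := by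
        ext I J
        exact hAsymm σ s I J
      have : (A' (s ∘ σ)).submatrix e e = A' s := by
        simp only [A', ← Matrix.submatrix_mul_equiv _ _ e e e]
        rw [hpow, hpow, hAe]
      exact congrFun₂ this I J
    have hA' : ∀ F, contraction A' F = contraction A F := by
      intro F
      rw [← hA, ← hinv T, hA fun i => (T : Matrix n n ℂ) * F i * ((T⁻¹ : GL n ℂ) : Matrix n n ℂ)]
      refine Finset.sum_congr rfl fun s _ => ?_
      have : tensorProd ((fun i => (T : Matrix n n ℂ) * F i *
          ((T⁻¹ : GL n ℂ) : Matrix n n ℂ)) ∘ s) = U * tensorProd (F ∘ s) * V := by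
        simp only [U, V, tensorProd_mul]
        rfl
      rw [this, ← mul_assoc, Matrix.trace_mul_comm _ V]
      simp only [A', mul_assoc]
    have hzero : A' - A = 0 := by
      refine eq_zero_of_contraction_eq_zero (fun σ s I J => ?_) fun F => ?_
      · simp only [Pi.sub_apply, Matrix.sub_apply, hA'symm, hAsymm]
      · rw [← sub_eq_zero.mpr (hA' F)]
        simp [contraction, sub_mul]
    intro s
    have hs : V * A s * U = A s := congrFun (sub_eq_zero.mp hzero) s
    calc A s * U = U * V * (A s * U) := by rw [hUV, one_mul]
      _ = U * (V * A s * U) := by simp only [mul_assoc]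
      _ = U * A s := by rw [hs]
  choose b hb using fun s => exists_eq_sum_permRep (A s) fun T => hcomm T s
  have hfun : (fun F : ι → Matrix n n ℂ => eval (fun v => F v.1 v.2.1 v.2.2) P) =
      ∑ s, ∑ σ, b s σ • fun F : ι → Matrix n n ℂ =>
        Matrix.trace (permRep (Fin d) n σ * tensorProd (F ∘ s)) := by
    funext F
    rw [hA, contraction]
    simp only [Finset.sum_apply, Pi.smul_apply]
    refine Finset.sum_congr rfl fun s _ => ?_
    rw [hb s, Finset.sum_mul, Matrix.trace_sum]
    simp
  rw [hfun]
  exact Submodule.sum_mem _ fun s _ => Submodule.sum_mem _ fun σ _ =>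
    Submodule.smul_mem _ _ (trace_permRep_mul_mem_span σ s)

lemma eval_smul_eq_sum {E : Type*} (P : MvPolynomial E ℂ) (t : ℂ) (x : E → ℂ) :
    eval (t • x) P =
      ∑ d ∈ Finset.range (P.totalDegree + 1), t ^ d * eval x (homogeneousComponent d P) := by
  conv_lhs => rw [← sum_homogeneousComponent P, map_sum]
  refine Finset.sum_congr rfl fun d _ => ?_
  have h := homogeneousComponent_isHomogeneous d P
  rw [eval_eq, eval_eq, Finset.mul_sum]
  refine Finset.sum_congr rfl fun m hm => ?_
  rw [h.degree_eq_sum_deg_support hm, ← Finset.prod_pow_eq_pow_sum]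
  simp only [Pi.smul_apply, smul_eq_mul, mul_pow, Finset.prod_mul_distrib]
  ring

/-- If all dilates of two points have equal values under a polynomial, then so do the points under
each homogeneous component. -/
lemma eval_homogeneousComponent_eq {E : Type*} (P : MvPolynomial E ℂ) {x y : E → ℂ}
    (h : ∀ t : ℂ, eval (t • x) P = eval (t • y) P) (d : ℕ) :
    eval x (homogeneousComponent d P) = eval y (homogeneousComponent d P) := by
  by_cases hd : d < P.totalDegree + 1
  · let p : (E → ℂ) → Polynomial ℂ := fun z => ∑ d ∈ Finset.range (P.totalDegree + 1),
      Polynomial.monomial d (eval z (homogeneousComponent d P))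
    have hp : p x = p y := Polynomial.funext fun t => by
      have := h t
      rw [eval_smul_eq_sum, eval_smul_eq_sum] at this
      simpa [p, Polynomial.eval_finsetSum, mul_comm] using this
    have := congrArg (Polynomial.coeff · d) hp
    simpa [p, Polynomial.finsetSum_coeff, Polynomial.coeff_monomial, hd] using this
  · rw [homogeneousComponent_eq_zero _ _ (by omega), map_zero, map_zero]

end TraceInvariants


/-- Specialization of Theorem thm:poly_fft to matrix tuples: every polynomial in
the entries invariant under simultaneous conjugation is a linear combination of
products of traces of words. -/
theorem stmt5 {ι : Type*} [Fintype ι] {q : ℕ} (hq : 0 < q)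
    (P : MvPolynomial (ι × Fin q × Fin q) ℂ)
    (hinv : ∀ (T : GL (Fin q) ℂ) (F : ι → Matrix (Fin q) (Fin q) ℂ),
      MvPolynomial.eval (fun v : ι × Fin q × Fin q =>
          ((T : Matrix (Fin q) (Fin q) ℂ) * F v.1 *
            ((T⁻¹ : GL (Fin q) ℂ) : Matrix (Fin q) (Fin q) ℂ)) v.2.1 v.2.2) P =
      MvPolynomial.eval (fun v : ι × Fin q × Fin q => F v.1 v.2.1 v.2.2) P) :
    ∃ (m : ℕ) (c : Fin m → ℂ) (W : Fin m → List (List ι)),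
      ∀ F : ι → Matrix (Fin q) (Fin q) ℂ,
        MvPolynomial.eval (fun v : ι × Fin q × Fin q => F v.1 v.2.1 v.2.2) P =
        ∑ k : Fin m, c k *
          ((W k).map (fun w : List ι => Matrix.trace ((w.map F).prod))).prod := by
  have hmem : (fun F : ι → Matrix (Fin q) (Fin q) ℂ =>
      MvPolynomial.eval (fun v : ι × Fin q × Fin q => F v.1 v.2.1 v.2.2) P) ∈
      Submodule.span ℂ (Set.range TraceInvariants.traceMonomial) := by
    have hsum : (fun F : ι → Matrix (Fin q) (Fin q) ℂ =>
        MvPolynomial.eval (fun v : ι × Fin q × Fin q => F v.1 v.2.1 v.2.2) P) =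
        ∑ d ∈ Finset.range (P.totalDegree + 1), fun F : ι → Matrix (Fin q) (Fin q) ℂ =>
          MvPolynomial.eval (fun v : ι × Fin q × Fin q => F v.1 v.2.1 v.2.2)
            (MvPolynomial.homogeneousComponent d P) := by
      funext F
      rw [Finset.sum_apply, ← map_sum, MvPolynomial.sum_homogeneousComponent]
    rw [hsum]
    refine Submodule.sum_mem _ fun d _ => TraceInvariants.homogeneous_mem_span
      (MvPolynomial.homogeneousComponent_isHomogeneous d P) fun T F =>
      TraceInvariants.eval_homogeneousComponent_eq P (fun t => ?_) d
    have h := hinv T (t • F)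
    simp only [Pi.smul_apply, Matrix.mul_smul, Matrix.smul_mul, Matrix.smul_apply] at h
    exact h
  obtain ⟨m, c, g, hg⟩ := Submodule.mem_span_set'.mp hmem
  choose W hW using fun k => (g k).2
  refine ⟨m, c, W, fun F => ?_⟩
  rw [← congrFun hg F, Finset.sum_apply]
  refine Finset.sum_congr rfl fun k _ => ?_
  rw [Pi.smul_apply, ← hW k]
  rfl
end

section
/- Let q be a positive natural number and T : Matrix (Fin q) (Fin q) ℂ. Then there exists a permutation σ : Equiv.Perm (Fin q) such that T is the permutation matrix of σ (T i j = if i = σ j then 1 else 0) if and only if T preserves the equality tensors of arity 2 and 3, i.e., ∀ i j : Fin q, (∑ a, T i a * T j a) = (if i = j then 1 else 0), and ∀ i j k : Fin q, (∑ a, T i a * T j a * T k a) = (if i = j ∧ j = k then 1 else 0). (Paper's Proposition prop:bounded; note the first condition already forces T to be invertible, with TTᵀ = I.) -/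
/-- A square matrix preserving the equality tensors of arity 2 and 3 has columns consisting of
pairwise orthogonal idempotents. -/
theorem mul_apply_eq_ite_of_preserves {n R : Type*} [Fintype n] [DecidableEq n] [CommRing R]
    {T : Matrix n n R} (h2 : ∀ i j, (∑ a, T i a * T j a) = if i = j then 1 else 0)
    (h3 : ∀ i j k, (∑ a, T i a * T j a * T k a) = if i = j ∧ j = k then 1 else 0) (i j a : n) :
    T i a * T j a = if i = j then T i a else 0 := by
  have hT : T.transpose * T = 1 := by
    rw [mul_eq_one_comm]
    ext i j
    simpa [Matrix.mul_apply, Matrix.one_apply] using h2 i j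
  have hinj : Function.Injective T.mulVec := by
    intro v w h
    simpa [Matrix.mulVec_mulVec, hT] using congrArg T.transpose.mulVec h
  refine congrFun (hinj (a₁ := fun a => T i a * T j a)
    (a₂ := fun a => if i = j then T i a else 0) ?_) a
  ext k
  have h := h3 i j k
  by_cases hij : i = j
  · subst hij
    simpa [Matrix.mulVec, dotProduct, mul_comm, mul_left_comm, h2, eq_comm] using h
  · simpa [Matrix.mulVec, dotProduct, mul_comm, mul_left_comm, hij] using h

/-- Proposition prop:bounded: a matrix is a permutation matrix iff it preserves
the equality tensors of arity 2 and 3. -/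
theorem stmt6 {q : ℕ} (hq : 0 < q) (T : Matrix (Fin q) (Fin q) ℂ) :
    (∃ σ : Equiv.Perm (Fin q), ∀ i j : Fin q, T i j = if i = σ j then 1 else 0) ↔
    ((∀ i j : Fin q, (∑ a : Fin q, T i a * T j a) = if i = j then 1 else 0) ∧
     (∀ i j k : Fin q, (∑ a : Fin q, T i a * T j a * T k a) =
        if i = j ∧ j = k then 1 else 0)) := by
  constructor
  · rintro ⟨σ, hσ⟩
    refine ⟨fun i j => ?_, fun i j k => ?_⟩
    · simp only [hσ]
      rw [Equiv.sum_comp σ fun b => (if i = b then (1 : ℂ) else 0) * if j = b then 1 else 0]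
      simp
    · simp only [hσ]
      rw [Equiv.sum_comp σ fun b => ((if i = b then (1 : ℂ) else 0) * if j = b then 1 else 0) *
        if k = b then 1 else 0]
      simp only [ite_mul, one_mul, zero_mul, Finset.sum_ite_eq, Finset.mem_univ, if_true]
      grind
  · rintro ⟨h2, h3⟩
    have hmul := mul_apply_eq_ite_of_preserves h2 h3
    have hT : T.transpose * T = 1 := by
      rw [mul_eq_one_comm]
      ext i j
      simpa [Matrix.mul_apply, Matrix.one_apply] using h2 i j
    have hcol : ∀ a b, ∑ i, T i a * T i b = if a = b then 1 else 0 := fun a b => by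
      simpa [Matrix.mul_apply, Matrix.one_apply] using congrFun (congrFun hT a) b
    have hex : ∀ a, ∃ i, T i a = 1 := by
      intro a
      obtain ⟨i, -, hi⟩ := Finset.exists_ne_zero_of_sum_ne_zero
        (s := Finset.univ) (f := fun i => T i a * T i a) (by simp [hcol])
      have hi' := left_ne_zero_of_mul hi
      exact ⟨i, mul_left_cancel₀ hi' (by simpa using hmul i i a)⟩
    choose f hf using hex
    have hval : ∀ i a, T i a = if i = f a then 1 else 0 := by
      intro i a
      have h := hmul i (f a) a
      split_ifs at h ⊢ with hi
      · rw [hi, hf]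
      · simpa [hf] using h
    have hinj : Function.Injective f := by
      intro a b hab
      by_contra hne
      have h := hcol a b
      simp [hval, hab, hne] at h
    exact ⟨Equiv.ofBijective f (Finite.injective_iff_bijective.mp hinj), hval⟩
end

section
/- Let V and W be finite types and let F : SimpleGraph V and G : SimpleGraph W (with decidable adjacency) be simple graphs whose adjacency matrices over ℂ are invertible (IsUnit (F.adjMatrix ℂ) and IsUnit (G.adjMatrix ℂ)). Then hom(X, F) = hom(X, G) for every finite simple graph X in which every vertex has degree at most 3, if and only if F and G are isomorphic, i.e., Nonempty (F ≃g G). (Paper's corollary in Section 6.1: for graphs with nonsingular adjacency matrices, homomorphism indistinguishability over graphs of maximum degree at most three is equivalent to isomorphism.) -/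
/-- If `L` is an injective linear map and `S` contains `1` and is closed under `x, y ↦ L (x * y)`,
then the span of `S` is closed under multiplication. -/
theorem Submodule.mul_mem_span_of_injective {k E : Type*} [Field k] [Ring E] [Algebra k E]
    [FiniteDimensional k E] {S : Set E} {L : E →ₗ[k] E} (hL : Function.Injective L)
    (h_one : (1 : E) ∈ S) (h_mul : ∀ x ∈ S, ∀ y ∈ S, L (x * y) ∈ S) {x y : E}
    (hx : x ∈ Submodule.span k S) (hy : y ∈ Submodule.span k S) :
    x * y ∈ Submodule.span k S := by
  have h_map : (span k S).map L = span k S := by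
    refine eq_of_le_of_finrank_eq ?_ (LinearEquiv.finrank_eq (equivMapOfInjective L hL _)).symm
    rw [map_span, span_le]
    rintro _ ⟨x, hx, rfl⟩
    simpa using subset_span (h_mul x hx 1 h_one)
  have h_comap : (span k S).comap L = span k S := by
    conv_lhs => rw [← h_map]
    exact comap_map_eq_of_injective hL _
  have h_le : span k S * span k S ≤ span k S := by
    rw [span_mul_span, span_le]
    rintro _ ⟨x, hx, y, hy, rfl⟩
    rw [SetLike.mem_coe, ← h_comap]
    exact subset_span (h_mul x hx y hy)
  exact h_le (mul_mem_mul hx hy)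

namespace Matrix

/-- The tensor power of a square matrix, with factors indexed by `K`. -/
def tensorPower {V R : Type*} [CommSemiring R] (K : Type*) [Fintype K] (A : Matrix V V R) :
    Matrix (K → V) (K → V) R :=
  of fun φ χ => ∏ i, A (φ i) (χ i)

variable {K V R : Type*} [Fintype K] [CommSemiring R]

theorem tensorPower_mul [DecidableEq K] [Fintype V] (A B : Matrix V V R) :
    tensorPower K A * tensorPower K B = tensorPower K (A * B) := by
  ext φ χ
  simp [tensorPower, mul_apply, Finset.prod_univ_sum, Finset.prod_mul_distrib]

theorem tensorPower_one [DecidableEq K] [DecidableEq V] :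
    tensorPower K (1 : Matrix V V R) = 1 := by
  ext φ χ
  simp only [tensorPower, of_apply, one_apply, Finset.prod_boole, funext_iff, Finset.mem_univ,
    true_imp_iff]

theorem tensorPower_mulVec_injective [DecidableEq K] [Fintype V] [DecidableEq V]
    {A : Matrix V V R} (hA : IsUnit A) :
    Function.Injective (tensorPower K A).mulVecLin := by
  obtain ⟨B, hB⟩ := hA.exists_left_inv
  refine Function.LeftInverse.injective (g := (tensorPower K B).mulVec) fun x => ?_
  rw [mulVecLin_apply, mulVec_mulVec, tensorPower_mul, hB, tensorPower_one, one_mulVec]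

end Matrix

namespace SimpleGraph

section RootedHomCount

universe u

variable {K T T' : Type u} {V : Type*}

/-- `K`-rooted graphs in which roots have degree at most one and all degrees are at most three. -/
def IsRootedSubcubic (X : SimpleGraph (K ⊕ T)) : Prop :=
  (∀ i, (X.neighborSet (.inl i)).encard ≤ 1) ∧ ∀ t, (X.neighborSet (.inr t)).encard ≤ 3

open Classical in
/-- The number of homomorphisms from `X` to `H` that extend a given map on the roots. -/
noncomputable def rootedHomCount [Fintype T] [Fintype V] (X : SimpleGraph (K ⊕ T))
    (H : SimpleGraph V) (φ : K → V) : ℂ :=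
  ∑ ψ : T → V, if X ≤ H.comap (Sum.elim φ ψ) then 1 else 0

open Classical in
theorem rootedHomCount_apply [DecidableEq T] [Fintype T] [Fintype V] (X : SimpleGraph (K ⊕ T))
    (H : SimpleGraph V) (φ : K → V) :
    X.rootedHomCount H φ = ∑ ψ : T → V, if X ≤ H.comap (Sum.elim φ ψ) then 1 else 0 := by
  rw [rootedHomCount]
  congr!

theorem sum_rootedHomCount [Fintype K] [DecidableEq K] [Fintype T] [Fintype V]
    (X : SimpleGraph (K ⊕ T)) (H : SimpleGraph V) [Fintype (X →g H)] :
    ∑ φ, X.rootedHomCount H φ = Fintype.card (X →g H) := by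
  classical
  have e : (X →g H) ≃ {h : K ⊕ T → V // X ≤ H.comap h} :=
    { toFun f := ⟨f, fun _ _ hab => f.map_adj hab⟩
      invFun h := ⟨h.1, fun hab => h.2 hab⟩
      left_inv _ := rfl
      right_inv _ := rfl }
  rw [Fintype.card_congr e, Fintype.card_subtype]
  simp only [rootedHomCount]
  rw [← Fintype.sum_prod_type', Finset.card_filter, Nat.cast_sum,
    ← (Equiv.sumArrowEquivProdArrow K T V).symm.sum_comp]
  refine Finset.sum_congr rfl fun p _ => ?_
  push_cast
  rfl

/-- The graph in which each root is joined to its copy by an edge. -/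
def rootMatching (K R : Type*) : SimpleGraph (K ⊕ (K ⊕ R)) :=
  fromRel fun a b => ∃ i, a = .inl i ∧ b = .inr (.inl i)

/-- The graph obtained by gluing two rooted graphs along their roots and then attaching to each
root a pendant edge whose other end is the new root. -/
def glueExtend (X : SimpleGraph (K ⊕ T)) (Y : SimpleGraph (K ⊕ T')) :
    SimpleGraph (K ⊕ (K ⊕ (T ⊕ T'))) :=
  rootMatching K (T ⊕ T') ⊔
    (X.map (Sum.inr ∘ Sum.map id Sum.inl) ⊔ Y.map (Sum.inr ∘ Sum.map id Sum.inr))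

theorem IsRootedSubcubic.glueExtend {X : SimpleGraph (K ⊕ T)} {Y : SimpleGraph (K ⊕ T')}
    (hX : X.IsRootedSubcubic) (hY : Y.IsRootedSubcubic) :
    (X.glueExtend Y).IsRootedSubcubic := by
  have bound {α β : Type u} {s : Set β} {t : Set α} {f : α → β} {n : ℕ∞} (h : s ⊆ f '' t)
      (ht : t.encard ≤ n) : s.encard ≤ n :=
    (Set.encard_le_encard h).trans ((Set.encard_image_le f t).trans ht)
  refine ⟨fun i => ?_, ?_⟩
  · refine (Set.encard_le_encard (t := {.inr (.inl i)}) fun b hb => ?_).trans (by simp)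
    simp [SimpleGraph.glueExtend, rootMatching, map_adj'] at hb
    grind
  rintro (i | t | t)
  · have h : (X.glueExtend Y).neighborSet (.inr (.inl i)) ⊆ {.inl i} ∪
        ((Sum.inr ∘ Sum.map id Sum.inl) '' X.neighborSet (.inl i) ∪
          (Sum.inr ∘ Sum.map id Sum.inr) '' Y.neighborSet (.inl i)) := by
      intro b hb
      simp [SimpleGraph.glueExtend, rootMatching, map_adj'] at hb
      simp
      grind
    grw [h, Set.encard_union_le, Set.encard_union_le, Set.encard_image_le, Set.encard_image_le,
      hX.1, hY.1, Set.encard_singleton]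
    norm_num
  · refine bound (f := Sum.inr ∘ Sum.map id Sum.inl) (t := X.neighborSet (.inr t)) ?_ (hX.2 t)
    intro b hb
    simp [SimpleGraph.glueExtend, rootMatching, map_adj'] at hb
    simp
    grind
  · refine bound (f := Sum.inr ∘ Sum.map id Sum.inr) (t := Y.neighborSet (.inr t)) ?_ (hY.2 t)
    intro b hb
    simp [SimpleGraph.glueExtend, rootMatching, map_adj'] at hb
    simp
    grind

theorem rootMatching_le_comap {R : Type*} {H : SimpleGraph V} {φ χ : K → V} {ψ : R → V} :
    rootMatching K R ≤ H.comap (Sum.elim φ (Sum.elim χ ψ)) ↔ ∀ i, H.Adj (φ i) (χ i) := by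
  refine ⟨fun h i => h (v := .inl i) (w := .inr (.inl i)) ?_, ?_⟩
  · simp [rootMatching]
  · rintro h a b ⟨-, ⟨i, rfl, rfl⟩ | ⟨i, rfl, rfl⟩⟩
    exacts [h i, (h i).symm]

theorem rootedHomCount_glueExtend [Fintype K] [DecidableEq K] [Fintype T] [Fintype T'] [Fintype V]
    [DecidableEq V] (X : SimpleGraph (K ⊕ T)) (Y : SimpleGraph (K ⊕ T')) (H : SimpleGraph V)
    [DecidableRel H.Adj] :
    (X.glueExtend Y).rootedHomCount H =
      ((H.adjMatrix ℂ).tensorPower K).mulVecLin (X.rootedHomCount H * Y.rootedHomCount H) := by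
  classical
  have map_le {α β : Type u} (f : α → β) (hf : f.Injective) (X : SimpleGraph α)
      (H : SimpleGraph β) : X.map f ≤ H ↔ X ≤ H.comap f := map_le_iff_le_comap ⟨f, hf⟩ X H
  ext φ
  simp only [Matrix.mulVecLin_apply, Matrix.mulVec, dotProduct, Matrix.tensorPower, Matrix.of_apply,
    adjMatrix_apply, Finset.prod_boole, Pi.mul_apply, rootedHomCount_apply, Finset.sum_mul_sum]
  refine (Fintype.sum_equiv (Equiv.sumArrowEquivProdArrow K (T ⊕ T') V) _ (fun p =>
    if X.glueExtend Y ≤ H.comap (Sum.elim φ (Sum.elim p.1 p.2)) then 1 else 0)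
    fun ψ => by simp [Equiv.sumArrowEquivProdArrow]).trans ?_
  rw [Fintype.sum_prod_type]
  refine Finset.sum_congr rfl fun χ _ => ?_
  refine (Fintype.sum_equiv (Equiv.sumArrowEquivProdArrow T T' V) _ (fun p =>
    if X.glueExtend Y ≤ H.comap (Sum.elim φ (Sum.elim χ (Sum.elim p.1 p.2))) then 1 else 0)
    fun ψ => by simp [Equiv.sumArrowEquivProdArrow]).trans ?_
  rw [Fintype.sum_prod_type, Finset.mul_sum]
  refine Finset.sum_congr rfl fun ψ _ => ?_
  rw [Finset.mul_sum]
  refine Finset.sum_congr rfl fun ψ' _ => ?_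
  have h : X.glueExtend Y ≤ H.comap (Sum.elim φ (Sum.elim χ (Sum.elim ψ ψ'))) ↔
      (∀ i, H.Adj (φ i) (χ i)) ∧ X ≤ H.comap (Sum.elim χ ψ) ∧ Y ≤ H.comap (Sum.elim χ ψ') := by
    rw [glueExtend, sup_le_iff, sup_le_iff, rootMatching_le_comap, map_le, map_le, comap_comap,
      comap_comap, ← Function.comp_assoc, ← Function.comp_assoc, Sum.elim_comp_inr,
      Sum.elim_comp_map, Sum.elim_comp_map]
    · simp
    · exact Sum.inr_injective.comp (Function.injective_id.sumMap Sum.inr_injective)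
    · exact Sum.inr_injective.comp (Function.injective_id.sumMap Sum.inl_injective)
  rw [if_congr h rfl rfl]
  simp only [Finset.mem_univ, true_imp_iff, ite_and, ite_mul, one_mul, zero_mul]

theorem isRootedSubcubic_bot : (⊥ : SimpleGraph (K ⊕ T)).IsRootedSubcubic := by
  simp [IsRootedSubcubic, neighborSet]

theorem isRootedSubcubic_edge (i j : K) :
    (edge (Sum.inl i) (Sum.inl j) : SimpleGraph (K ⊕ T)).IsRootedSubcubic := by
  refine ⟨fun k => Set.encard_le_one_iff.2 fun a b ha hb => ?_, fun t => ?_⟩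
  · simp only [mem_neighborSet, edge_adj] at ha hb
    grind
  · have h : (edge (Sum.inl i) (Sum.inl j) : SimpleGraph (K ⊕ T)).neighborSet (.inr t) = ∅ := by
      ext
      simp [edge_adj]
    simp [h]

theorem rootedHomCount_bot [Fintype V] (H : SimpleGraph V) :
    (⊥ : SimpleGraph (K ⊕ PEmpty)).rootedHomCount H = 1 := by
  ext φ
  simp [rootedHomCount]

theorem rootedHomCount_edge [Fintype V] (H : SimpleGraph V) [DecidableRel H.Adj] {i j : K}
    (hij : i ≠ j) (φ : K → V) :
    (edge (Sum.inl i) (Sum.inl j) : SimpleGraph (K ⊕ PEmpty)).rootedHomCount H φ =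
      if H.Adj (φ i) (φ j) then 1 else 0 := by
  simp [rootedHomCount, hij]

end RootedHomCount

/-- `F` and `G` admit equally many homomorphisms from each graph of maximum degree at most `d`. -/
def HomIndistinguishable {V W : Type*} [Fintype V] [Fintype W] [DecidableEq V] [DecidableEq W]
    (d : ℕ) (F : SimpleGraph V) (G : SimpleGraph W) [DecidableRel F.Adj] [DecidableRel G.Adj] :
    Prop :=
  ∀ (n : ℕ) (X : SimpleGraph (Fin n)) [DecidableRel X.Adj], (∀ v : Fin n, X.degree v ≤ d) →
    Fintype.card (X →g F) = Fintype.card (X →g G)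

universe u v

variable {V : Type u} {W : Type v} [Fintype V] [Fintype W] [DecidableEq V] [DecidableEq W]
  {F : SimpleGraph V} {G : SimpleGraph W} [DecidableRel F.Adj] [DecidableRel G.Adj]

theorem HomIndistinguishable.symm {d : ℕ} (h : HomIndistinguishable d F G) :
    HomIndistinguishable d G F :=
  fun n X _ hX => (h n X hX).symm

theorem HomIndistinguishable.card_hom_eq {d : ℕ} (h : HomIndistinguishable d F G) {U : Type*}
    [Fintype U] (X : SimpleGraph U) (hX : ∀ a, (X.neighborSet a).encard ≤ d)
    [Fintype (X →g F)] [Fintype (X →g G)] :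
    Fintype.card (X →g F) = Fintype.card (X →g G) := by
  classical
  let e := X.overFinIso rfl
  have hd (a) : (X.overFin rfl).degree a ≤ d := by
    rw [← e.apply_symm_apply a, e.degree_eq]
    have := hX (e.symm a)
    rwa [← coe_neighborFinset, Set.encard_coe_eq_coe_finsetCard, Nat.cast_le] at this
  rw [Fintype.card_congr (Iso.homCongr e Iso.refl), Fintype.card_congr (Iso.homCongr e Iso.refl)]
  exact h _ _ hd

/-- The pairs of root-extension counts into `F` and `G` arising from a rooted subcubic graph. -/
def rootedHomCountPairs (K : Type u) {V W : Type*} [Fintype V] [Fintype W]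
    (F : SimpleGraph V) (G : SimpleGraph W) :
    Set (((K → V) → ℂ) × ((K → W) → ℂ)) :=
  {p | ∃ (T : Type u) (_ : Fintype T) (X : SimpleGraph (K ⊕ T)),
    X.IsRootedSubcubic ∧ p = (X.rootedHomCount F, X.rootedHomCount G)}

theorem one_mem_rootedHomCountPairs {K : Type u} {V W : Type*} [Fintype V] [Fintype W]
    {F : SimpleGraph V} {G : SimpleGraph W} : 1 ∈ rootedHomCountPairs K F G :=
  ⟨PEmpty, inferInstance, ⊥, isRootedSubcubic_bot, by
    rw [rootedHomCount_bot, rootedHomCount_bot, Prod.mk_one_one]⟩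

theorem mul_mem_span_rootedHomCountPairs {K : Type u} [Fintype K] [DecidableEq K]
    (hF : IsUnit (F.adjMatrix ℂ)) (hG : IsUnit (G.adjMatrix ℂ))
    {x y : ((K → V) → ℂ) × ((K → W) → ℂ)}
    (hx : x ∈ Submodule.span ℂ (rootedHomCountPairs K F G))
    (hy : y ∈ Submodule.span ℂ (rootedHomCountPairs K F G)) :
    x * y ∈ Submodule.span ℂ (rootedHomCountPairs K F G) := by
  refine Submodule.mul_mem_span_of_injective
    (L := ((F.adjMatrix ℂ).tensorPower K).mulVecLin.prodMap
      ((G.adjMatrix ℂ).tensorPower K).mulVecLin)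
    ((Matrix.tensorPower_mulVec_injective hF).prodMap (Matrix.tensorPower_mulVec_injective hG))
    one_mem_rootedHomCountPairs ?_ hx hy
  rintro _ ⟨T, _, X, hX, rfl⟩ _ ⟨T', _, Y, hY, rfl⟩
  refine ⟨K ⊕ (T ⊕ T'), inferInstance, X.glueExtend Y, hX.glueExtend hY, ?_⟩
  rw [rootedHomCount_glueExtend, rootedHomCount_glueExtend]
  rfl

theorem HomIndistinguishable.sum_fst_eq_sum_snd (h : HomIndistinguishable 3 F G) {K : Type u}
    [Fintype K] [DecidableEq K] {x : ((K → V) → ℂ) × ((K → W) → ℂ)}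
    (hx : x ∈ Submodule.span ℂ (rootedHomCountPairs K F G)) :
    ∑ φ, x.1 φ = ∑ φ, x.2 φ := by
  classical
  induction hx using Submodule.span_induction with
  | mem x hx =>
    obtain ⟨T, _, X, hX, rfl⟩ := hx
    rw [sum_rootedHomCount, sum_rootedHomCount, h.card_hom_eq X]
    rintro (i | t)
    exacts [(hX.1 i).trans (by norm_num), hX.2 t]
  | zero => simp
  | add x y _ _ hx hy => simp [Finset.sum_add_distrib, hx, hy]
  | smul c x _ hx => simp [← Finset.mul_sum, hx]

theorem prod_ite_adj {V W : Type*} [Fintype V] (F : SimpleGraph V) (G : SimpleGraph W)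
    [DecidableRel F.Adj] [DecidableRel G.Adj] (φ : V → W) [Decidable (∀ i j, F.Adj i j ↔ G.Adj (φ i) (φ j))] :
    (∏ i, ∏ j, if F.Adj i j then (if G.Adj (φ i) (φ j) then 1 else 0)
      else 1 - (if G.Adj (φ i) (φ j) then 1 else 0)) =
      if ∀ i j, F.Adj i j ↔ G.Adj (φ i) (φ j) then (1 : ℂ) else 0 := by
  have h_factor (i j : V) : (if F.Adj i j then (if G.Adj (φ i) (φ j) then (1 : ℂ) else 0)
      else 1 - (if G.Adj (φ i) (φ j) then 1 else 0)) =
      if F.Adj i j ↔ G.Adj (φ i) (φ j) then 1 else 0 := by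
    by_cases hij : F.Adj i j <;> simp [hij, ite_not, sub_ite]
  simp [h_factor, Finset.prod_boole]

theorem HomIndistinguishable.exists_adj_iff (h : HomIndistinguishable 3 F G)
    (hF : IsUnit (F.adjMatrix ℂ)) (hG : IsUnit (G.adjMatrix ℂ)) :
    ∃ φ : V → W, ∀ i j, F.Adj i j ↔ G.Adj (φ i) (φ j) := by
  classical
  let A : Subalgebra ℂ (((V → V) → ℂ) × ((V → W) → ℂ)) :=
    (Submodule.span ℂ (rootedHomCountPairs V F G)).toSubalgebra
      (Submodule.subset_span one_mem_rootedHomCountPairs)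
      fun _ _ => mul_mem_span_rootedHomCountPairs hF hG
  let e (i j : V) : ((V → V) → ℂ) × ((V → W) → ℂ) :=
    (fun φ => if F.Adj (φ i) (φ j) then 1 else 0, fun φ => if G.Adj (φ i) (φ j) then 1 else 0)
  have he (i j : V) : e i j ∈ A := by
    obtain rfl | hij := eq_or_ne i j
    · convert A.zero_mem
      ext <;> simp [e]
    · refine Submodule.subset_span ⟨PEmpty, inferInstance, _, isRootedSubcubic_edge i j, ?_⟩
      ext φ <;> simp only [e, rootedHomCount_edge _ hij]
  let p := ∏ i, ∏ j, if F.Adj i j then e i j else 1 - e i j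
  have hp : p ∈ A := A.prod_mem fun i _ => A.prod_mem fun j _ => by
    split_ifs
    exacts [he i j, A.sub_mem A.one_mem (he i j)]
  have hp₁ (φ : V → V) :
      p.1 φ = if ∀ i j, F.Adj i j ↔ F.Adj (φ i) (φ j) then 1 else 0 := by
    simp only [← prod_ite_adj, p, Prod.fst_prod, Finset.prod_apply]
    refine Finset.prod_congr rfl fun i _ => Finset.prod_congr rfl fun j _ => ?_
    by_cases hij : F.Adj i j <;> simp [e, hij]
  have hp₂ (φ : V → W) :
      p.2 φ = if ∀ i j, F.Adj i j ↔ G.Adj (φ i) (φ j) then 1 else 0 := by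
    simp only [← prod_ite_adj, p, Prod.snd_prod, Finset.prod_apply]
    refine Finset.prod_congr rfl fun i _ => Finset.prod_congr rfl fun j _ => ?_
    by_cases hij : F.Adj i j <;> simp [e, hij]
  by_contra hφ
  have hsum := h.sum_fst_eq_sum_snd hp
  simp_rw [hp₁, hp₂, Finset.sum_boole] at hsum
  rw [Finset.filter_false_of_mem (s := (Finset.univ : Finset (V → W))) (fun φ _ h => hφ ⟨φ, h⟩),
    Finset.card_empty, Nat.cast_inj, Finset.card_eq_zero] at hsum
  exact Finset.eq_empty_iff_forall_notMem.1 hsum id (by simp)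

theorem injective_of_adj_iff {V W : Type*} [Fintype V] [DecidableEq V] {F : SimpleGraph V}
    {G : SimpleGraph W} [DecidableRel F.Adj] (hF : IsUnit (F.adjMatrix ℂ)) {φ : V → W}
    (hφ : ∀ i j, F.Adj i j ↔ G.Adj (φ i) (φ j)) : Function.Injective φ := by
  intro i j hij
  refine (Matrix.linearIndependent_rows_iff_isUnit.2 hF).injective (funext fun k => ?_)
  simp [adjMatrix_apply, show F.Adj i k ↔ F.Adj j k by rw [hφ, hφ, hij]]

theorem HomIndistinguishable.nonempty_iso (h : HomIndistinguishable 3 F G)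
    (hF : IsUnit (F.adjMatrix ℂ)) (hG : IsUnit (G.adjMatrix ℂ)) : Nonempty (F ≃g G) := by
  obtain ⟨φ, hφ⟩ := h.exists_adj_iff hF hG
  obtain ⟨ψ, hψ⟩ := h.symm.exists_adj_iff hG hF
  have h_inj := injective_of_adj_iff hF hφ
  have h_card := (Fintype.card_le_of_injective φ h_inj).antisymm
    (Fintype.card_le_of_injective ψ (injective_of_adj_iff hG hψ))
  exact ⟨⟨.ofBijective φ ((Fintype.bijective_iff_injective_and_card φ).2 ⟨h_inj, h_card⟩),
    fun {i j} => (hφ i j).symm⟩⟩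

end SimpleGraph


/-- Section 6.1 corollary: graphs with nonsingular adjacency matrices are
homomorphism-indistinguishable over graphs of maximum degree at most 3 iff
they are isomorphic. -/
theorem stmt7 {V W : Type*} [Fintype V] [Fintype W] [DecidableEq V] [DecidableEq W]
    (F : SimpleGraph V) (G : SimpleGraph W) [DecidableRel F.Adj] [DecidableRel G.Adj]
    (hF : IsUnit (F.adjMatrix ℂ)) (hG : IsUnit (G.adjMatrix ℂ)) :
    (∀ (n : ℕ) (X : SimpleGraph (Fin n)) [DecidableRel X.Adj],
        (∀ v : Fin n, X.degree v ≤ 3) →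
        Fintype.card (X →g F) = Fintype.card (X →g G)) ↔
    Nonempty (F ≃g G) := by
  exact ⟨fun h => SimpleGraph.HomIndistinguishable.nonempty_iso h hF hG,
    fun ⟨e⟩ _ _ _ _ => Fintype.card_congr (SimpleGraph.Iso.homCongr .refl e)⟩
end
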